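/- arXiv:1705.05346 — 5 statements merged into one kernel-verified Lean document; each statement's English description precedes it below -/
import Mathlib

section
/- Let N and k be positive integers with k < N and k ∈ {1, 2}. If u : ℝ^N → ℝ is lower semicontinuous, nonnegative, and a viscosity supersolution of P⁺_k(D²u) = 0 in ℝ^N, then u is constant. -/
open scoped BigOperators

/-- The eigenvalues of a symmetric real matrix, listed in nondecreasing order with
multiplicity (junk value `0` if the matrix is not Hermitian). -/
noncomputable def sortedEig {n : ℕ} (A : Matrix (Fin n) (Fin n) ℝ) : Fin n → ℝ :=
  if h : A.IsHermitian then h.eigenvalues ∘ Tuple.sort h.eigenvalues else 0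

/-- `P⁻_k(A)`: the sum of the `k` smallest eigenvalues of `A`. -/
noncomputable def Pminus {n : ℕ} (k : ℕ) (A : Matrix (Fin n) (Fin n) ℝ) : ℝ :=
  ∑ i : Fin n, if (i : ℕ) < k then sortedEig A i else 0

/-- `P⁺_k(A)`: the sum of the `k` largest eigenvalues of `A`. -/
noncomputable def Pplus {n : ℕ} (k : ℕ) (A : Matrix (Fin n) (Fin n) ℝ) : ℝ :=
  ∑ i : Fin n, if n - k ≤ (i : ℕ) then sortedEig A i else 0

/-- The Hessian matrix `D²u(x)` of `u : ℝ^N → ℝ` at `x`. -/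
noncomputable def hessianMatrix {N : ℕ} (u : EuclideanSpace ℝ (Fin N) → ℝ)
    (x : EuclideanSpace ℝ (Fin N)) : Matrix (Fin N) (Fin N) ℝ :=
  fun i j => iteratedFDeriv ℝ 2 u x ![EuclideanSpace.single i 1, EuclideanSpace.single j 1]

/-- `u` is a viscosity supersolution of `F(D²u) + g(u) = 0` in `Ω`. -/
def IsViscositySupersolution {N : ℕ} (F : Matrix (Fin N) (Fin N) ℝ → ℝ) (g : ℝ → ℝ)
    (Ω : Set (EuclideanSpace ℝ (Fin N))) (u : EuclideanSpace ℝ (Fin N) → ℝ) : Prop :=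
  ∀ x₀ ∈ Ω, ∀ φ : EuclideanSpace ℝ (Fin N) → ℝ, ContDiff ℝ 2 φ →
    IsLocalMinOn (fun x => u x - φ x) Ω x₀ →
      F (hessianMatrix φ x₀) + g (u x₀) ≤ 0

/-- `u` is a viscosity subsolution of `F(D²u) + g(u) = 0` in `Ω`. -/
def IsViscositySubsolution {N : ℕ} (F : Matrix (Fin N) (Fin N) ℝ → ℝ) (g : ℝ → ℝ)
    (Ω : Set (EuclideanSpace ℝ (Fin N))) (u : EuclideanSpace ℝ (Fin N) → ℝ) : Prop :=
  ∀ x₀ ∈ Ω, ∀ φ : EuclideanSpace ℝ (Fin N) → ℝ, ContDiff ℝ 2 φ →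
    IsLocalMaxOn (fun x => u x - φ x) Ω x₀ →
      0 ≤ F (hessianMatrix φ x₀) + g (u x₀)

/-- `u` is a viscosity solution of `F(D²u) + g(u) = 0` in `Ω`. -/
def IsViscositySolution {N : ℕ} (F : Matrix (Fin N) (Fin N) ℝ → ℝ) (g : ℝ → ℝ)
    (Ω : Set (EuclideanSpace ℝ (Fin N))) (u : EuclideanSpace ℝ (Fin N) → ℝ) : Prop :=
  IsViscositySubsolution F g Ω u ∧ IsViscositySupersolution F g Ω u


/-- Lower bound for `P⁺_k` (`k = 1, 2`) of a rank-one perturbation of a multiple of the identity. -/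
lemma Pplus_pos_of_form {N k : ℕ} (hkN : k < N) (hk12 : k = 1 ∨ k = 2)
    (A : Matrix (Fin N) (Fin N) ℝ) (a b : ℝ) (v : Fin N → ℝ)
    (hA : ∀ i j, A i j = a * (if i = j then 1 else 0) + b * (v i * v j))
    (ha : a < 0) (hb : 0 < b) (hv : 0 < ∑ i, v i * v i)
    (hpos : 0 < a + (a + b * ∑ i, v i * v i)) :
    0 < Pplus k A := by
  have hH : A.IsHermitian := by
    ext i j
    simp only [Matrix.conjTranspose_apply, hA, star_trivial]
    by_cases h : i = j
    · subst h; rfl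
    · simp [h, Ne.symm h, mul_comm]
  set S := ∑ i, v i * v i with hS
  -- every eigenvalue is `a` or `a + b S`
  have heig : ∀ l, hH.eigenvalues l = a ∨ hH.eigenvalues l = a + b * S := by
    intro l
    set w : Fin N → ℝ := (hH.eigenvectorBasis l).ofLp with hw
    set lam := hH.eigenvalues l with hlam
    have h1 : ∀ i, a * w i + b * v i * (∑ j, v j * w j) = lam * w i := by
      intro i
      have h2 := congrFun (hH.mulVec_eigenvectorBasis l) i
      simp only [Matrix.mulVec, dotProduct, hA, Pi.smul_apply, smul_eq_mul] at h2
      rw [hw, hlam, ← h2, Finset.mul_sum]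
      simp only [add_mul, Finset.sum_add_distrib]
      congr 1
      · simp
      · exact Finset.sum_congr rfl fun j _ => by ring
    by_cases hd : (∑ j, v j * w j) = 0
    · left
      by_contra hne
      have hw0 : ∀ i, w i = 0 := by
        intro i
        have := h1 i
        rw [hd] at this
        have h3 : (lam - a) * w i = 0 := by linarith
        exact (mul_eq_zero.mp h3).resolve_left (sub_ne_zero.mpr hne)
      have hz : hH.eigenvectorBasis l = 0 := by
        ext i; simpa using hw0 i
      have := hH.eigenvectorBasis.orthonormal.1 l
      rw [hz] at this
      simp at this
    · right
      have h4 : ∑ i, v i * (a * w i + b * v i * (∑ j, v j * w j))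
          = ∑ i, v i * (lam * w i) := Finset.sum_congr rfl fun i _ => by rw [h1 i]
      have h5 : ∑ i, v i * (a * w i + b * v i * (∑ j, v j * w j))
          = a * (∑ j, v j * w j) + b * S * (∑ j, v j * w j) := by
        have h7 : ∀ D : ℝ, ∑ i, v i * (a * w i + b * v i * D)
            = a * (∑ j, v j * w j) + b * (∑ j, v j * v j) * D := by
          intro D
          rw [Finset.mul_sum, Finset.mul_sum, Finset.sum_mul, ← Finset.sum_add_distrib]
          exact Finset.sum_congr rfl fun i _ => by ring
        exact h7 _
      have h6 : ∑ i, v i * (lam * w i) = lam * (∑ j, v j * w j) := by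
        rw [Finset.mul_sum]
        exact Finset.sum_congr rfl fun i _ => by ring
      rw [h5, h6] at h4
      have : (a + b * S - lam) * (∑ j, v j * w j) = 0 := by linarith
      have := (mul_eq_zero.mp this).resolve_right hd
      linarith
  have hbS : 0 < b * S := mul_pos hb hv
  have hex : ∃ l, hH.eigenvalues l = a + b * S := by
    by_contra hno
    push Not at hno
    have hall : ∀ l, hH.eigenvalues l = a := fun l => (heig l).resolve_right (hno l)
    have ht := hH.trace_eq_sum_eigenvalues
    simp only [Matrix.trace, Matrix.diag, hA, hall] at ht
    simp only [Finset.sum_add_distrib, ← Finset.mul_sum] at ht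
    simp at ht
    rw [← hS] at ht
    linarith
  have hse : ∀ i, sortedEig A i = hH.eigenvalues (Tuple.sort hH.eigenvalues i) := by
    intro i; rw [sortedEig, dif_pos hH]; rfl
  have hlow : ∀ i, a ≤ sortedEig A i := by
    intro i
    rw [hse]
    rcases heig (Tuple.sort hH.eigenvalues i) with h | h <;> rw [h]
    linarith
  have hN : N - 1 < N := by omega
  have htop : a + b * S ≤ sortedEig A ⟨N - 1, hN⟩ := by
    obtain ⟨l, hl⟩ := hex
    rw [← hl, hse]
    have hm := Tuple.monotone_sort hH.eigenvalues
    have := @hm ((Tuple.sort hH.eigenvalues).symm l) ⟨N - 1, hN⟩ (by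
      rw [Fin.le_def]
      have := ((Tuple.sort hH.eigenvalues).symm l).2
      simp only
      omega)
    simpa using this
  unfold Pplus
  rw [← Finset.sum_filter]
  rcases hk12 with rfl | rfl
  · have : (Finset.univ.filter fun i : Fin N => N - 1 ≤ (i : ℕ)) = {⟨N - 1, hN⟩} := by
      ext i
      simp only [Finset.mem_filter, Finset.mem_univ, true_and, Finset.mem_singleton, Fin.ext_iff]
      omega
    rw [this, Finset.sum_singleton]
    linarith
  · have hN2 : N - 2 < N := by omega
    have : (Finset.univ.filter fun i : Fin N => N - 2 ≤ (i : ℕ))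
        = {⟨N - 2, hN2⟩, ⟨N - 1, hN⟩} := by
      ext i
      simp only [Finset.mem_filter, Finset.mem_univ, true_and, Finset.mem_singleton,
        Finset.mem_insert, Fin.ext_iff]
      omega
    rw [this, Finset.sum_pair (by simp only [ne_eq, Fin.ext_iff]; omega)]
    have := hlow ⟨N - 2, hN2⟩
    linarith

/-- Hessian of a function of the squared distance. -/
lemma hessian_radial {N : ℕ} (y x : EuclideanSpace ℝ (Fin N)) (g gone : ℝ → ℝ) (gtwo : ℝ)
    (hg : ∀ s, 0 ≤ s → HasDerivAt g (gone s) s)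
    (hgd : HasDerivAt gone gtwo (‖x - y‖ ^ 2)) (i j : Fin N) :
    hessianMatrix (fun z => g (‖z - y‖ ^ 2)) x i j
      = 2 * gone (‖x - y‖ ^ 2) * (if i = j then 1 else 0)
        + 4 * gtwo * ((x - y) i * (x - y) j) := by
  have hq : ∀ z : EuclideanSpace ℝ (Fin N),
      HasFDerivAt (fun z => ‖z - y‖ ^ 2) ((2 : ℝ) • innerSL ℝ (z - y)) z := by
    intro z
    have := ((hasFDerivAt_id z).sub_const y).norm_sq
    refine this.congr_fderiv ?_
    ext w; simp
  have h1 : fderiv ℝ (fun z => g (‖z - y‖ ^ 2))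
      = fun z => gone (‖z - y‖ ^ 2) • ((2 : ℝ) • innerSL ℝ (z - y)) := by
    funext z
    exact ((hg _ (by positivity)).comp_hasFDerivAt z (hq z)).fderiv
  have hin : HasFDerivAt (fun z : EuclideanSpace ℝ (Fin N) => (2 : ℝ) • innerSL ℝ (z - y))
      ((2 : ℝ) • (innerSL ℝ : EuclideanSpace ℝ (Fin N) →L[ℝ] _)) x := by
    have := (((innerSL ℝ : EuclideanSpace ℝ (Fin N) →L[ℝ] _).hasFDerivAt
      (x := x - y)).comp x ((hasFDerivAt_id x).sub_const y)).const_smul (2 : ℝ)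
    refine this.congr_fderiv ?_
    ext w; simp
  have h2 := (hgd.comp_hasFDerivAt x (hq x)).smul hin
  unfold hessianMatrix
  rw [iteratedFDeriv_two_apply, h1]
  have h3 := h2.fderiv
  simp only [Function.comp_def] at h3
  erw [h3]
  simp [EuclideanSpace.inner_single_right]
  have h4 : (innerSL ℝ (EuclideanSpace.single i (1 : ℝ))) (EuclideanSpace.single j (1 : ℝ))
      = if i = j then (1 : ℝ) else 0 := by
    change inner ℝ (EuclideanSpace.single i (1 : ℝ)) (EuclideanSpace.single j (1 : ℝ)) = _
    rw [EuclideanSpace.inner_single_left]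
    simp
  erw [h4]
  split_ifs <;> ring

/-- The comparison function. -/
noncomputable def cmpFun {N : ℕ} (c : ℝ) (y x : EuclideanSpace ℝ (Fin N)) : ℝ :=
  Real.log (1 + Real.log (1 + ‖x - y‖ ^ 2 / c))

lemma log_part_nonneg {c s : ℝ} (hc : 0 < c) (hs : 0 ≤ s) : 0 ≤ Real.log (1 + s / c) :=
  Real.log_nonneg (by have := div_nonneg hs hc.le; linarith)

lemma cmpFun_nonneg {N : ℕ} {c : ℝ} (hc : 0 < c) (y x : EuclideanSpace ℝ (Fin N)) :
    0 ≤ cmpFun c y x :=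
  Real.log_nonneg (by have := log_part_nonneg hc (sq_nonneg ‖x - y‖); linarith)

lemma cmpFun_contDiff {N : ℕ} {c : ℝ} (hc : 0 < c) (y : EuclideanSpace ℝ (Fin N)) :
    ContDiff ℝ 2 (cmpFun c y) := by
  unfold cmpFun
  have h0 : ContDiff ℝ 2 (fun x : EuclideanSpace ℝ (Fin N) => 1 + ‖x - y‖ ^ 2 / c) :=
    contDiff_const.add (((contDiff_id.sub contDiff_const).norm_sq ℝ).div_const c)
  refine (contDiff_const.add (h0.log ?_)).log ?_
  · intro x
    have : 0 ≤ ‖x - y‖ ^ 2 / c := by positivity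
    positivity
  · intro x
    have := log_part_nonneg hc (sq_nonneg ‖x - y‖)
    positivity

lemma cmpFun_tendsto {N : ℕ} {c : ℝ} (hc : 0 < c) (y : EuclideanSpace ℝ (Fin N)) :
    Filter.Tendsto (cmpFun c y) (Filter.cocompact _) Filter.atTop := by
  unfold cmpFun
  refine Real.tendsto_log_atTop.comp (Filter.tendsto_atTop_add_const_left _ _
    (Real.tendsto_log_atTop.comp (Filter.tendsto_atTop_add_const_left _ _
      (Filter.Tendsto.atTop_div_const hc ?_))))
  have h1 : Filter.Tendsto (fun x : EuclideanSpace ℝ (Fin N) => ‖x - y‖)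
      (Filter.cocompact _) Filter.atTop := by
    simpa [dist_eq_norm] using tendsto_dist_right_cocompact_atTop y
  exact (Filter.tendsto_pow_atTop two_ne_zero).comp h1

/-- The comparison function is a strict subsolution away from the centre. -/
lemma cmpFun_strict {N k : ℕ} (hkN : k < N) (hk12 : k = 1 ∨ k = 2) {c e : ℝ} (hc : 0 < c)
    (he : 0 < e) (y x : EuclideanSpace ℝ (Fin N)) (hx : 3 * c ≤ ‖x - y‖ ^ 2) :
    0 < Pplus k (hessianMatrix (fun z => -e * cmpFun c y z) x) := by
  set L : ℝ → ℝ := fun s => Real.log (1 + s / c) with hL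
  have hLnn : ∀ s, 0 ≤ s → 0 ≤ L s := fun s hs => log_part_nonneg hc hs
  have hLd : ∀ s, 0 ≤ s → HasDerivAt L (1 / (c + s)) s := by
    intro s hs
    have h0 : HasDerivAt (fun s : ℝ => 1 + s / c) (1 / c) s :=
      ((hasDerivAt_id s).div_const c).const_add 1
    have h1 : (1 + s / c) ≠ 0 := by positivity
    convert h0.log h1 using 1
    field_simp
  set g : ℝ → ℝ := fun s => -e * Real.log (1 + L s) with hgdef
  set gone : ℝ → ℝ := fun s => -e / ((1 + L s) * (c + s)) with hgd_def
  have hg : ∀ s, 0 ≤ s → HasDerivAt g (gone s) s := by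
    intro s hs
    have h1 : 1 + L s ≠ 0 := by have := hLnn s hs; positivity
    have h2 : c + s ≠ 0 := by positivity
    have := (((hLd s hs).const_add 1).log h1).const_mul (-e)
    refine HasDerivAt.congr_deriv this ?_
    change _ = -e / ((1 + L s) * (c + s))
    field_simp
  set q := ‖x - y‖ ^ 2 with hq
  have hq0 : 0 < q := by linarith
  have hLq := hLnn q hq0.le
  have p1 : 0 < 1 + L q := by linarith
  have p2 : 0 < c + q := by linarith
  set g2 : ℝ := e * (2 + L q) / ((1 + L q) ^ 2 * (c + q) ^ 2) with hg2
  have hgd : HasDerivAt gone g2 q := by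
    have h3 : HasDerivAt (fun s => (1 + L s) * (c + s))
        (1 / (c + q) * (c + q) + (1 + L q) * 1) q :=
      ((hLd q hq0.le).const_add 1).mul ((hasDerivAt_id q).const_add c)
    have := (hasDerivAt_const q (-e)).div h3 (by positivity)
    refine HasDerivAt.congr_deriv this ?_
    change _ = e * (2 + L q) / ((1 + L q) ^ 2 * (c + q) ^ 2)
    field_simp
    ring
  have hlt : c * (1 + L q) < q := by
    have hlog : L q ≤ 1 / 4 * (1 + q / c) - 1 + Real.log 4 := by
      have h5 : 0 < 1 + q / c := by positivity
      have := Real.log_le_sub_one_of_pos (show 0 < (1 + q / c) / 4 by positivity)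
      rw [Real.log_div h5.ne' (by norm_num)] at this
      simp only [hL]
      linarith
    have h4 : Real.log 4 < 2 := by
      have : Real.log 4 = 2 * Real.log 2 := by
        rw [show (4 : ℝ) = 2 ^ 2 by norm_num, Real.log_pow]; norm_num
      have := Real.log_two_lt_d9
      linarith
    have h4b : Real.log 4 < 1.4 := by
      have : Real.log 4 = 2 * Real.log 2 := by
        rw [show (4 : ℝ) = 2 ^ 2 by norm_num, Real.log_pow]; norm_num
      have := Real.log_two_lt_d9
      linarith
    have hqc : 3 ≤ q / c := by rw [le_div_iff₀ hc]; exact hx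
    have : 1 + L q < q / c := by linarith
    rw [lt_div_iff₀ hc] at this
    linarith
  have hsum : ∑ i, (x - y) i * (x - y) i = q := by
    rw [hq, EuclideanSpace.norm_sq_eq]
    exact Finset.sum_congr rfl fun i _ => by rw [Real.norm_eq_abs, sq_abs, sq]
  refine Pplus_pos_of_form hkN hk12 _ (2 * gone q) (4 * g2) (fun i => (x - y) i)
    (fun i j => ?_) ?_ ?_ ?_ ?_
  · exact hessian_radial y x g gone g2 hg hgd i j
  · have : gone q < 0 := by
      simp only [hgd_def]
      exact div_neg_of_neg_of_pos (by linarith) (by positivity)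
    linarith
  · have : 0 < 2 + L q := by linarith
    positivity
  · rw [hsum]; exact hq0
  · rw [hsum]
    have : 2 * gone q + (2 * gone q + 4 * g2 * q)
        = 4 * e * (q - c * (1 + L q)) / ((1 + L q) ^ 2 * (c + q) ^ 2) := by
      simp only [hgd_def, hg2]
      field_simp
      ring
    rw [this]
    have : 0 < q - c * (1 + L q) := by linarith
    positivity

theorem statement1 (N k : ℕ) (hk : 0 < k) (hkN : k < N) (hk12 : k = 1 ∨ k = 2)
    (u : EuclideanSpace ℝ (Fin N) → ℝ) (hlsc : LowerSemicontinuous u)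
    (hnn : ∀ x, 0 ≤ u x)
    (hsuper : IsViscositySupersolution (Pplus k) (fun _ => 0) Set.univ u) :
    ∃ c : ℝ, ∀ x, u x = c := by
  have key : ∀ (y : EuclideanSpace ℝ (Fin N)) (r e : ℝ), 0 < r → 0 < e →
      ∃ x₀ ∈ Metric.ball y r, ∀ x, u x₀ ≤ u x + e * cmpFun (r ^ 2 / 3) y x := by
    intro y r e hr he
    have hc : 0 < r ^ 2 / 3 := by positivity
    set h := cmpFun (r ^ 2 / 3) y with hh
    have hcont : Continuous h := (cmpFun_contDiff hc y).continuous
    have hl : LowerSemicontinuous (fun x => u x + e * h x) :=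
      hlsc.add (continuous_const.mul hcont).lowerSemicontinuous
    -- a global minimum exists
    have hmin : ∃ x₀, ∀ x, u x₀ + e * h x₀ ≤ u x + e * h x := by
      have hev : ∀ᶠ x in Filter.cocompact _, u y + e * h y ≤ e * h x :=
        ((cmpFun_tendsto hc y).const_mul_atTop he).eventually_ge_atTop _
      obtain ⟨K, hK, hKs⟩ := Filter.mem_cocompact.mp hev
      obtain ⟨x₀, -, hx₀⟩ := LowerSemicontinuousOn.exists_isMinOn
        (s := insert y K) ⟨y, Set.mem_insert _ _⟩ (hK.insert y) (hl.lowerSemicontinuousOn _)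
      refine ⟨x₀, fun x => ?_⟩
      by_cases hx : x ∈ insert y K
      · exact hx₀ hx
      · have h1 : u x₀ + e * h x₀ ≤ u y + e * h y := hx₀ (Set.mem_insert _ _)
        have h2 : u y + e * h y ≤ e * h x :=
          hKs (fun hxK => hx (Set.mem_insert_of_mem _ hxK))
        have := hnn x
        linarith
    obtain ⟨x₀, hx₀⟩ := hmin
    refine ⟨x₀, ?_, fun x => ?_⟩
    · by_contra hnot
      rw [Metric.mem_ball, not_lt, dist_eq_norm] at hnot
      have hpos := cmpFun_strict hkN hk12 hc he y x₀ (by nlinarith)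
      have := hsuper x₀ (Set.mem_univ _) (fun z => -e * cmpFun (r ^ 2 / 3) y z)
        (contDiff_const.mul (cmpFun_contDiff hc y)) (Filter.Eventually.of_forall fun x => by
          have := hx₀ x
          simp only [hh] at this
          simp only
          linarith)
      simp only [add_zero] at this
      linarith
    · have := hx₀ x
      have := mul_nonneg he.le (cmpFun_nonneg hc y x₀)
      linarith
  have hle : ∀ y x, u y ≤ u x := by
    intro y x
    refine le_of_forall_lt fun a ha => ?_
    obtain ⟨b, hab, hb⟩ := exists_between ha
    refine lt_of_lt_of_le hab ?_
    obtain ⟨r, hr, hball⟩ := Metric.eventually_nhds_iff_ball.mp (hlsc y b hb)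
    refine le_of_forall_pos_le_add fun d hd => ?_
    have hc : 0 < r ^ 2 / 3 := by positivity
    have hh := cmpFun_nonneg hc y x
    obtain ⟨x₀, hx₀, hx⟩ := key y r (d / (1 + cmpFun (r ^ 2 / 3) y x)) hr (by positivity)
    have h1 := hball x₀ hx₀
    have h2 := hx x
    have h3 : d / (1 + cmpFun (r ^ 2 / 3) y x) * cmpFun (r ^ 2 / 3) y x ≤ d := by
      rw [div_mul_eq_mul_div, div_le_iff₀ (by positivity)]
      nlinarith
    linarith
  exact ⟨u 0, fun x => le_antisymm (hle x 0) (hle 0 x)⟩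
end

section
/- Let N and k be positive integers with 2 < k < N, and let 0 < p ≤ k/(k−2). If u : ℝ^N → ℝ is nonnegative, lower semicontinuous, and a viscosity supersolution of P⁺_k(D²u) + u^p = 0 in ℝ^N, then u is identically 0. -/
open scoped BigOperators

open Filter Topology

lemma Pplus_ge {n k : ℕ} (hk : 0 < k) (hkn : k ≤ n) (c d : ℝ) (hd : 0 ≤ d) (z : Fin n → ℝ)
    (A : Matrix (Fin n) (Fin n) ℝ)
    (hA : A = c • (1 : Matrix (Fin n) (Fin n) ℝ) + d • Matrix.vecMulVec z z) :
    k * c + d * (z ⬝ᵥ z) ≤ Pplus k A := by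
  have hH : A.IsHermitian := by
    rw [hA]
    ext i j
    simp [Matrix.vecMulVec_apply, Matrix.one_apply, eq_comm, mul_comm]
  have hmul : ∀ v : Fin n → ℝ, A.mulVec v = c • v + (d * (z ⬝ᵥ v)) • z := by
    intro v
    rw [hA, Matrix.add_mulVec, Matrix.smul_mulVec, Matrix.smul_mulVec, Matrix.one_mulVec,
      Matrix.vecMulVec_mulVec]
    ext i
    simp
    ring
  have hlow : ∀ i, c ≤ hH.eigenvalues i := by
    intro i
    have h1 := hH.mulVec_eigenvectorBasis i
    set v : Fin n → ℝ := (hH.eigenvectorBasis i).ofLp with hv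
    have hvv : v ⬝ᵥ v = 1 := by
      have := hH.eigenvectorBasis.orthonormal.1 i
      have h2 : inner ℝ (hH.eigenvectorBasis i) (hH.eigenvectorBasis i) = (1:ℝ) := by
        rw [real_inner_self_eq_norm_sq, this]; norm_num
      rw [EuclideanSpace.inner_eq_star_dotProduct] at h2
      simpa using h2
    rw [hmul] at h1
    have h3 := congrArg (fun w => v ⬝ᵥ w) h1
    simp only [dotProduct_add, dotProduct_smul, hvv, smul_eq_mul] at h3
    have h4 : v ⬝ᵥ z = z ⬝ᵥ v := dotProduct_comm _ _
    rw [h4] at h3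
    nlinarith [mul_nonneg hd (mul_self_nonneg (z ⬝ᵥ v))]
  have hS : sortedEig A = hH.eigenvalues ∘ Tuple.sort hH.eigenvalues := by
    unfold sortedEig
    rw [dif_pos hH]
  have hSlow : ∀ i, c ≤ sortedEig A i := by
    intro i; rw [hS]; exact hlow _
  have hmono : Monotone (sortedEig A) := by
    rw [hS]; exact Tuple.monotone_sort _
  obtain ⟨m, rfl⟩ : ∃ m, n = m + 1 := ⟨n - 1, by omega⟩
  have hlast : c + d * (z ⬝ᵥ z) ≤ sortedEig A (Fin.last m) := by
    by_cases hz : z = 0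
    · simp [hz]; exact hSlow _
    · have hev : Module.End.HasEigenvalue (Matrix.toLin' A) (c + d * (z ⬝ᵥ z)) := by
        apply Module.End.hasEigenvalue_of_hasEigenvector (x := z)
        rw [Module.End.hasEigenvector_iff]
        refine ⟨?_, hz⟩
        rw [Module.End.mem_eigenspace_iff, Matrix.toLin'_apply, hmul, add_smul]
      have hsp := hev.mem_spectrum
      rw [Matrix.spectrum_toLin', hH.spectrum_real_eq_range_eigenvalues] at hsp
      obtain ⟨j, hj⟩ := hsp
      rw [← hj]
      have := hmono (Fin.le_last ((Tuple.sort hH.eigenvalues).symm j))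
      simpa [hS] using this
  unfold Pplus
  rw [Fin.sum_univ_castSucc]
  have h1 : (if m + 1 - k ≤ ((Fin.last m : Fin (m+1)) : ℕ) then sortedEig A (Fin.last m) else 0)
      = sortedEig A (Fin.last m) := by
    rw [if_pos]; simp; omega
  rw [h1]
  have h2 : ((k:ℝ) - 1) * c ≤ ∑ i : Fin m, (if m + 1 - k ≤ ((Fin.castSucc i : Fin (m+1)) : ℕ)
      then sortedEig A (Fin.castSucc i) else 0) := by
    have : ((k:ℝ) - 1) * c = ∑ i : Fin m, (if m + 1 - k ≤ (i : ℕ) then c else 0) := by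
      rw [Fin.sum_univ_eq_sum_range (fun i => if m + 1 - k ≤ i then c else 0) m,
        ← Finset.sum_filter, Finset.sum_const, nsmul_eq_mul]
      congr 1
      have : (Finset.range m).filter (fun i => m + 1 - k ≤ i) = Finset.Ico (m+1-k) m := by
        ext i; simp; omega
      rw [this, Nat.card_Ico]
      have : m - (m + 1 - k) = k - 1 := by omega
      rw [this, Nat.cast_sub (by omega)]; simp
    rw [this]
    apply Finset.sum_le_sum
    intro i _
    simp only [Fin.val_castSucc]
    split_ifs
    · exact hSlow _
    · exact le_rfl
  linarith

lemma hess_radial {N : ℕ} (y x₀ : EuclideanSpace ℝ (Fin N)) (h h1 : ℝ → ℝ) (b : ℝ)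
    (φ : EuclideanSpace ℝ (Fin N) → ℝ)
    (hφ : φ =ᶠ[𝓝 x₀] fun x => h (‖x - y‖ ^ 2))
    (hd : ∀ᶠ s in 𝓝 (‖x₀ - y‖ ^ 2), HasDerivAt h (h1 s) s)
    (hd2 : HasDerivAt h1 b (‖x₀ - y‖ ^ 2)) :
    hessianMatrix φ x₀ = (2 * h1 (‖x₀ - y‖ ^ 2)) • (1 : Matrix (Fin N) (Fin N) ℝ)
      + (4 * b) • Matrix.vecMulVec (x₀ - y).ofLp (x₀ - y).ofLp := by
  have hsq : ∀ x : EuclideanSpace ℝ (Fin N),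
      HasFDerivAt (fun x => ‖x - y‖ ^ 2) (2 • innerSL ℝ (x - y)) x := by
    intro x
    have := ((hasFDerivAt_id x).sub_const y).norm_sq
    simpa using this
  have hcont : Continuous (fun x : EuclideanSpace ℝ (Fin N) => ‖x - y‖ ^ 2) := by fun_prop
  have hfd : fderiv ℝ φ =ᶠ[𝓝 x₀]
      fun x => h1 (‖x - y‖ ^ 2) • ((2:ℝ) • innerSL ℝ (x - y)) := by
    have e1 := hφ.fderiv (𝕜 := ℝ)
    have e2 := hcont.continuousAt.eventually hd
    filter_upwards [e1, e2] with x hx1 hx2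
    rw [hx1]
    have := (hx2.comp_hasFDerivAt x (hsq x)).fderiv
    rw [show (fun x => h (‖x - y‖ ^ 2)) = h ∘ (fun x => ‖x - y‖ ^ 2) from rfl, this]
    ext w; simp
  have hin : HasFDerivAt (fun x : EuclideanSpace ℝ (Fin N) => (2:ℝ) • innerSL ℝ (x - y))
      ((2:ℝ) • (innerSL ℝ : EuclideanSpace ℝ (Fin N) →L[ℝ] _)) x₀ := by
    have := ((innerSL ℝ : EuclideanSpace ℝ (Fin N) →L[ℝ] (EuclideanSpace ℝ (Fin N) →L[ℝ] ℝ)).hasFDerivAt (x := x₀ - y)).comp x₀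
      ((hasFDerivAt_id x₀).sub_const y)
    have := this.const_smul (2:ℝ)
    refine this.congr_of_eventuallyEq (Eventually.of_forall fun x => ?_)
    rfl
  have h2 := (hd2.comp_hasFDerivAt x₀ (hsq x₀)).smul hin
  have h3 := (h2.congr_of_eventuallyEq hfd).fderiv
  ext i j
  unfold hessianMatrix
  rw [iteratedFDeriv_two_apply]
  rw [h3]
  have hz : ∀ (z : EuclideanSpace ℝ (Fin N)) (i : Fin N),
      inner ℝ z (EuclideanSpace.single i (1:ℝ)) = z i := by
    intro z i
    simp [EuclideanSpace.inner_single_right]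
  simp only [Matrix.vecMulVec_apply, Matrix.one_apply, Matrix.add_apply, Matrix.smul_apply,
    add_apply, smul_apply, Function.comp,
    ContinuousLinearMap.smulRight_apply, innerSL_apply_apply, Matrix.cons_val_zero,
    Matrix.cons_val_one, smul_eq_mul, hz]
  have h7 : ((innerSL ℝ : EuclideanSpace ℝ (Fin N) →L[ℝ] (EuclideanSpace ℝ (Fin N) →L[ℝ] ℝ))
      (EuclideanSpace.single i (1:ℝ))) (EuclideanSpace.single j (1:ℝ))
      = if i = j then 1 else 0 := by
    have : (EuclideanSpace.single i (1:ℝ) : EuclideanSpace ℝ (Fin N)) j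
        = if i = j then 1 else 0 := by
      simp [eq_comm]
    rw [← this, ← hz]
    rfl
  rw [h7]
  simp
  ring_nf

lemma test_radial {N k : ℕ} (hk : 0 < k) (hkN : k ≤ N) {p : ℝ}
    {u : EuclideanSpace ℝ (Fin N) → ℝ}
    (hsuper : IsViscositySupersolution (Pplus k) (fun t => t ^ p) Set.univ u)
    (y x₀ : EuclideanSpace ℝ (Fin N)) (h h1 : ℝ → ℝ) (b s : ℝ) (hs : s = ‖x₀ - y‖ ^ 2)
    (hC : ContDiffAt ℝ 2 h s)
    (hd : ∀ᶠ s in 𝓝 s, HasDerivAt h (h1 s) s)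
    (hd2 : HasDerivAt h1 b s) (hb : 0 ≤ b)
    (hmin : IsLocalMin (fun x => u x - h (‖x - y‖ ^ 2)) x₀) :
    2 * k * h1 s + 4 * s * b + u x₀ ^ p ≤ 0 := by
  subst hs
  set g : EuclideanSpace ℝ (Fin N) → ℝ := fun x => h (‖x - y‖ ^ 2) with hg
  have hgC : ContDiffAt ℝ 2 g x₀ := by
    have : ContDiffAt ℝ 2 (fun x : EuclideanSpace ℝ (Fin N) => ‖x - y‖ ^ 2) x₀ :=
      ((contDiff_id.sub contDiff_const).norm_sq ℝ).contDiffAt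
    exact hC.comp x₀ this
  obtain ⟨φ, hφ, hφg⟩ : ∃ φ : EuclideanSpace ℝ (Fin N) → ℝ, ContDiff ℝ 2 φ ∧ φ =ᶠ[𝓝 x₀] g := by
    have hev : ∀ᶠ x in 𝓝 x₀, ContDiffAt ℝ 2 g x := hgC.eventually (by simp)
    obtain ⟨r, hr, hball⟩ := Metric.eventually_nhds_iff_ball.1 hev
    let f : ContDiffBump x₀ := ⟨r / 4, r / 2, by positivity, by linarith⟩
    refine ⟨fun x => f x * g x, ?_, ?_⟩
    · rw [contDiff_iff_contDiffAt]
      intro x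
      by_cases hx : x ∈ Metric.ball x₀ r
      · exact f.contDiff.contDiffAt.mul (hball x hx)
      · have : (fun x => f x * g x) =ᶠ[𝓝 x] fun _ => 0 := by
          have hx' : x ∈ (Metric.closedBall x₀ (r/2))ᶜ := by
            simp at hx ⊢; linarith
          filter_upwards [Metric.isClosed_closedBall.isOpen_compl.mem_nhds hx'] with z hz
          rw [f.zero_of_le_dist (by simp at hz; exact hz.le), zero_mul]
        exact contDiffAt_const.congr_of_eventuallyEq this
    · filter_upwards [f.eventuallyEq_one] with x hx
      simp [hx]
  have hH := hess_radial y x₀ h h1 b φ hφg hd hd2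
  have hm : IsLocalMinOn (fun x => u x - φ x) Set.univ x₀ := by
    rw [IsLocalMinOn, IsMinFilter, nhdsWithin_univ]
    have e0 := hφg.self_of_nhds
    filter_upwards [hmin, hφg] with x hx hx2
    rw [hx2, e0]; exact hx
  have h1' := hsuper x₀ (Set.mem_univ _) φ hφ hm
  have h2' := Pplus_ge hk hkN _ (4 * b) (by positivity) _ _ hH
  have h3' : (x₀ - y).ofLp ⬝ᵥ (x₀ - y).ofLp = ‖x₀ - y‖ ^ 2 := by
    rw [← real_inner_self_eq_norm_sq, EuclideanSpace.inner_eq_star_dotProduct]; simp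
  rw [h3'] at h2'
  simp only at h1'
  linarith

lemma compare {N : ℕ} {u : EuclideanSpace ℝ (Fin N) → ℝ} (hnn : ∀ x, 0 ≤ u x)
    (hlsc : LowerSemicontinuous u) (y : EuclideanSpace ℝ (Fin N)) (h : ℝ → ℝ) (s0 : ℝ)
    (hc : ContinuousOn h (Set.Ici s0)) (hlim : Tendsto h atTop (𝓝 0))
    (hbd : ∀ x, ‖x - y‖ ^ 2 = s0 → h s0 ≤ u x)
    (hno : ∀ x₀, s0 < ‖x₀ - y‖ ^ 2 → u x₀ < h (‖x₀ - y‖ ^ 2) →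
      IsLocalMin (fun x => u x - h (‖x - y‖ ^ 2)) x₀ → False) :
    ∀ x, s0 ≤ ‖x - y‖ ^ 2 → h (‖x - y‖ ^ 2) ≤ u x := by
  intro x1 hx1
  by_contra! hlt
  have hcont : Continuous (fun x : EuclideanSpace ℝ (Fin N) => ‖x - y‖ ^ 2) := by fun_prop
  set δ := h (‖x1 - y‖ ^ 2) - u x1 with hδ
  have hδ0 : 0 < δ := by linarith
  obtain ⟨R, hR⟩ := eventually_atTop.1 (hlim.eventually (gt_mem_nhds hδ0))
  set K : Set (EuclideanSpace ℝ (Fin N)) := {x | s0 ≤ ‖x - y‖ ^ 2} with hK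
  have hKc : IsClosed K := isClosed_le continuous_const hcont
  set w : EuclideanSpace ℝ (Fin N) → ℝ := fun x => u x - h (‖x - y‖ ^ 2) with hw
  set B := Metric.closedBall y (max (|R| + 1) ‖x1 - y‖) with hB
  have hcomp : IsCompact (K ∩ B) := (isCompact_closedBall _ _).inter_left hKc
  have hx1B : x1 ∈ K ∩ B := ⟨hx1, by simp [hB, dist_eq_norm]⟩
  have hlw : LowerSemicontinuousOn w (K ∩ B) := by
    have hcc : ContinuousOn (fun x => - h (‖x - y‖ ^ 2)) (K ∩ B) :=
      (hc.comp hcont.continuousOn (fun x hx => hx.1)).neg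
    have := (hlsc.lowerSemicontinuousOn (K ∩ B)).add hcc.lowerSemicontinuousOn
    simpa [hw, sub_eq_add_neg] using this
  obtain ⟨x₀, hx₀, hmin⟩ := hlw.exists_isMinOn ⟨x1, hx1B⟩ hcomp
  have h01 : w x₀ ≤ w x1 := hmin hx1B
  have hw1 : w x1 = -δ := by simp [hw, hδ]
  have hglob : ∀ x ∈ K, w x₀ ≤ w x := by
    intro x hx
    by_cases hxB : x ∈ B
    · exact hmin ⟨hx, hxB⟩
    · have : |R| + 1 < ‖x - y‖ := by
        simp [hB, dist_eq_norm] at hxB; exact hxB.1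
      have hr : R ≤ ‖x - y‖ ^ 2 := by
        nlinarith [abs_nonneg R, le_abs_self R]
      have := hR _ hr
      have h5 := hnn x
      have : -δ ≤ w x := by simp only [hw]; linarith
      linarith
  have hneg : u x₀ < h (‖x₀ - y‖ ^ 2) := by
    have : w x₀ < 0 := by linarith
    simp only [hw] at this; linarith
  have hs : s0 < ‖x₀ - y‖ ^ 2 := by
    refine lt_of_le_of_ne hx₀.1 fun he => ?_
    have := hbd x₀ he.symm
    rw [← he] at hneg; linarith
  refine hno x₀ hs hneg ?_
  have : ∀ᶠ x in 𝓝 x₀, s0 < ‖x - y‖ ^ 2 := hcont.continuousAt.eventually (lt_mem_nhds hs)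
  filter_upwards [this] with x hx
  exact hglob x hx.le

lemma hasDerivAt_pow' {s : ℝ} (hs : 0 < s) (β : ℝ) :
    HasDerivAt (fun t : ℝ => t ^ β) (β * s ^ (β - 1)) s :=
  Real.hasDerivAt_rpow_const (Or.inl hs.ne')

lemma tendsto_rpow_neg' {β : ℝ} (hβ : β < 0) : Tendsto (fun t : ℝ => t ^ β) atTop (𝓝 0) := by
  have := tendsto_rpow_neg_atTop (y := -β) (by linarith)
  simpa using this

/-- Step A. -/
lemma stepA {N k : ℕ} (hk : 2 < k) (hkN : k ≤ N) {p α : ℝ} (hα : (k : ℝ) = 2 * α + 2)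
    {u : EuclideanSpace ℝ (Fin N) → ℝ} (hnn : ∀ x, 0 ≤ u x) (hlsc : LowerSemicontinuous u)
    (hsuper : IsViscositySupersolution (Pplus k) (fun t => t ^ p) Set.univ u)
    (y : EuclideanSpace ℝ (Fin N)) (s0 m : ℝ) (hs0 : 0 < s0) (hm : 0 < m)
    (hum : ∀ x, ‖x - y‖ ^ 2 ≤ s0 → m ≤ u x) :
    ∃ c, 0 < c ∧ ∀ x, s0 ≤ ‖x - y‖ ^ 2 → c * (‖x - y‖ ^ 2) ^ (-α) ≤ u x := by
  have hα0 : 0 < α := by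
    have : (2:ℝ) < k := by exact_mod_cast hk
    linarith
  set D := s0 ^ (-α) + s0 ^ (-α - 1) with hD
  have hD0 : 0 < D := by positivity
  set K := m / D with hK
  have hK0 : 0 < K := by positivity
  have hder : ∀ s : ℝ, 0 < s → HasDerivAt (fun t : ℝ => K * (t ^ (-α) + t ^ (-α - 1)))
      (K * (-α * s ^ (-α - 1) + (-α - 1) * s ^ (-α - 1 - 1))) s := fun s hs =>
    ((hasDerivAt_pow' hs (-α)).add (hasDerivAt_pow' hs (-α - 1))).const_mul K
  refine ⟨K, hK0, ?_⟩
  have key := compare hnn hlsc y (fun t : ℝ => K * (t ^ (-α) + t ^ (-α - 1))) s0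
    (fun s hs => (hder s (lt_of_lt_of_le hs0 hs)).continuousAt.continuousWithinAt)
    (by
      have := ((tendsto_rpow_neg' (β := -α) (by linarith)).add
        (tendsto_rpow_neg' (β := -α - 1) (by linarith))).const_mul K
      simpa using this)
    (by
      intro x hx
      have : K * D = m := by rw [hK]; field_simp
      show K * D ≤ u x
      rw [this]; exact hum x hx.le)
    (by
      intro x₀ hs hlt hmin
      set s := ‖x₀ - y‖ ^ 2 with hsdef
      have hs' : 0 < s := hs0.trans hs
      have hd2 : HasDerivAt
          (fun s : ℝ => K * (-α * s ^ (-α - 1) + (-α - 1) * s ^ (-α - 1 - 1)))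
          (K * (-α * ((-α - 1) * s ^ (-α - 1 - 1))
            + (-α - 1) * ((-α - 1 - 1) * s ^ (-α - 1 - 1 - 1)))) s :=
        (((hasDerivAt_pow' hs' (-α - 1)).const_mul _).add
          ((hasDerivAt_pow' hs' (-α - 1 - 1)).const_mul _)).const_mul K
      have p1 : s ^ (-α - 1) = s ^ (-α - 1 - 1 - 1) * s ^ 2 := by
        rw [← Real.rpow_natCast s 2, ← Real.rpow_add hs']; congr 1; push_cast; ring
      have p2 : s ^ (-α - 1 - 1) = s ^ (-α - 1 - 1 - 1) * s := by
        rw [← Real.rpow_add_one hs'.ne']; congr 1; ring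
      have hq : 0 < s ^ (-α - 1 - 1 - 1) := by positivity
      have hT := test_radial (by omega) hkN hsuper y x₀
        (fun t : ℝ => K * (t ^ (-α) + t ^ (-α - 1))) _ _ s hsdef
        (by
          have e1 : ContDiffAt ℝ 2 (fun t : ℝ => t ^ (-α)) s :=
            Real.contDiffAt_rpow_const_of_ne hs'.ne'
          have e2 : ContDiffAt ℝ 2 (fun t : ℝ => t ^ (-α - 1)) s :=
            Real.contDiffAt_rpow_const_of_ne hs'.ne'
          exact contDiffAt_const.mul (e1.add e2))
        (by filter_upwards [lt_mem_nhds hs'] with t ht using hder t ht) hd2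
        (by
          have : 0 ≤ s ^ (-α - 1 - 1) := by positivity
          have e : (K * (-α * ((-α - 1) * s ^ (-α - 1 - 1))
            + (-α - 1) * ((-α - 1 - 1) * s ^ (-α - 1 - 1 - 1)))) =
            (K * (α * ((α + 1) * s ^ (-α - 1 - 1))
            + (α + 1) * ((α + 1 + 1) * s ^ (-α - 1 - 1 - 1)))) := by ring
          rw [e]; positivity) hmin
      have hup : 0 ≤ u x₀ ^ p := Real.rpow_nonneg (hnn _) _
      rw [p1, p2, hα] at hT
      have : 0 < 4 * K * (α + 1) * (s ^ (-α - 1 - 1 - 1) * s) := by positivity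
      nlinarith)
  intro x hx
  refine le_trans ?_ (key x hx)
  have : 0 ≤ (‖x - y‖ ^ 2) ^ (-α - 1) := by positivity
  show _ ≤ K * (_ + _)
  nlinarith

/-- Step B. -/
lemma stepB {N k : ℕ} (hk : 2 < k) (hkN : k ≤ N) {p α : ℝ} (hα : (k : ℝ) = 2 * α + 2)
    (hp0 : 0 < p) (hp : α * p ≤ α + 1)
    {u : EuclideanSpace ℝ (Fin N) → ℝ} (hnn : ∀ x, 0 ≤ u x) (hlsc : LowerSemicontinuous u)
    (hsuper : IsViscositySupersolution (Pplus k) (fun t => t ^ p) Set.univ u)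
    (y : EuclideanSpace ℝ (Fin N)) (s0 c : ℝ) (hc : 0 < c)
    (hum : ∀ x, s0 ≤ ‖x - y‖ ^ 2 → c * (‖x - y‖ ^ 2) ^ (-α) ≤ u x) :
    ∃ ε s1, 0 < ε ∧ 1 < s1 ∧ ∀ x, s1 ≤ ‖x - y‖ ^ 2 →
      ε * ((‖x - y‖ ^ 2) ^ (-α) * Real.log (‖x - y‖ ^ 2)) ≤ u x := by
  have hα0 : 0 < α := by
    have : (2:ℝ) < k := by exact_mod_cast hk
    linarith
  set s1 := max s0 (Real.exp (2 / α)) with hs1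
  have hs1e : Real.exp (2 / α) ≤ s1 := le_max_right _ _
  have hs1g : 1 < s1 := lt_of_lt_of_le (Real.one_lt_exp_iff.2 (by positivity)) hs1e
  have hl1 : 0 < Real.log s1 := Real.log_pos hs1g
  set ε := min (c / Real.log s1) (c ^ p / (8 * α)) with hε
  have hε0 : 0 < ε := by positivity
  have hε1 : ε * Real.log s1 ≤ c := by
    have : ε ≤ c / Real.log s1 := min_le_left _ _
    rwa [le_div_iff₀ hl1] at this
  have hε2 : ε * (8 * α) ≤ c ^ p := by
    have : ε ≤ c ^ p / (8 * α) := min_le_right _ _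
    rwa [le_div_iff₀ (by positivity)] at this
  have hder : ∀ s : ℝ, 0 < s → HasDerivAt (fun t : ℝ => ε * (t ^ (-α) * Real.log t))
      (ε * (s ^ (-α - 1) * (1 - α * Real.log s))) s := by
    intro s hs
    refine (((hasDerivAt_pow' hs (-α)).mul (Real.hasDerivAt_log hs.ne')).const_mul ε).congr_deriv ?_
    rw [Real.rpow_sub_one hs.ne']; field_simp; ring
  refine ⟨ε, s1, hε0, hs1g, ?_⟩
  refine compare hnn hlsc y (fun t : ℝ => ε * (t ^ (-α) * Real.log t)) s1
    (fun s hs => (hder s (by have : s1 ≤ s := hs; linarith)).continuousAt.continuousWithinAt)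
    ?_ ?_ ?_
  · have h1 := (isLittleO_log_rpow_atTop hα0).tendsto_div_nhds_zero
    have h2 := h1.const_mul ε
    rw [mul_zero] at h2
    refine h2.congr' ?_
    filter_upwards [eventually_gt_atTop 0] with t ht
    rw [Real.rpow_neg ht.le]; ring
  · intro x hx
    have h1 := hum x (by rw [hx]; exact le_max_left _ _)
    rw [hx] at h1
    refine le_trans ?_ h1
    have : 0 < s1 ^ (-α) := by positivity
    show ε * (s1 ^ (-α) * Real.log s1) ≤ _
    nlinarith
  · intro x₀ hs hlt hmin
    set s := ‖x₀ - y‖ ^ 2 with hsdef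
    have hs' : 0 < s := by linarith
    have hd2 : HasDerivAt (fun s : ℝ => ε * (s ^ (-α - 1) * (1 - α * Real.log s)))
        (ε * (s ^ (-α - 1 - 1) * (α * (α + 1) * Real.log s - (2 * α + 1)))) s := by
      refine (((hasDerivAt_pow' hs' (-α - 1)).mul
        (((Real.hasDerivAt_log hs'.ne').const_mul α).const_sub 1)).const_mul ε).congr_deriv ?_
      rw [Real.rpow_sub_one hs'.ne' (-α - 1)]; field_simp; ring
    have hlog : 2 / α ≤ Real.log s := by
      rw [Real.le_log_iff_exp_le hs']; linarith
    have hlog' : 2 ≤ α * Real.log s := by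
      rw [div_le_iff₀ hα0] at hlog; linarith
    have hT := test_radial (by omega) hkN hsuper y x₀
        (fun t : ℝ => ε * (t ^ (-α) * Real.log t)) _ _ s hsdef
      (by
        have e1 : ContDiffAt ℝ 2 (fun t : ℝ => t ^ (-α)) s :=
          Real.contDiffAt_rpow_const_of_ne hs'.ne'
        have e2 : ContDiffAt ℝ 2 Real.log s := Real.contDiffAt_log.2 hs'.ne'
        exact contDiffAt_const.mul (e1.mul e2))
      (by filter_upwards [lt_mem_nhds hs'] with t ht using hder t ht) hd2
      (by
        have : 0 ≤ α * (α + 1) * Real.log s - (2 * α + 1) := by nlinarith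
        positivity) hmin
    have p1 : s ^ (-α - 1) = s ^ (-α - 1 - 1) * s := by
      rw [← Real.rpow_add_one hs'.ne']; congr 1; ring
    have hup : c ^ p * s ^ (-α - 1) ≤ u x₀ ^ p := by
      have h1 := hum x₀ ((le_max_left _ _).trans hs.le)
      calc c ^ p * s ^ (-α - 1) ≤ c ^ p * s ^ (-α * p) := by
            gcongr
            · linarith
            · linarith
        _ = (c * s ^ (-α)) ^ p := by
            rw [Real.mul_rpow hc.le (by positivity), ← Real.rpow_mul hs'.le]
        _ ≤ u x₀ ^ p := Real.rpow_le_rpow (by positivity) h1 hp0.le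
    have e : 2 * (k:ℝ) * (ε * (s ^ (-α - 1) * (1 - α * Real.log s)))
        + 4 * s * (ε * (s ^ (-α - 1 - 1) * (α * (α + 1) * Real.log s - (2 * α + 1))))
        = - (4 * α * ε) * s ^ (-α - 1) := by
      rw [p1, hα]; ring
    rw [e] at hT
    have hq : 0 < s ^ (-α - 1) := by positivity
    have : 0 < ε * α := by positivity
    nlinarith

/-- Bubble estimate. -/
lemma stepC {N k : ℕ} (hk : 2 < k) (hkN : k ≤ N) {p α : ℝ} (hα : (k : ℝ) = 2 * α + 2)
    (hp : α * p ≤ α + 1)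
    {u : EuclideanSpace ℝ (Fin N) → ℝ} (hlsc : LowerSemicontinuous u)
    (hsuper : IsViscositySupersolution (Pplus k) (fun t => t ^ p) Set.univ u)
    (y : EuclideanSpace ℝ (Fin N)) (hpos : ∀ x, 0 < u x)
    (hcoer : ∀ M : ℝ, ∃ R : ℝ, ∀ x, R ≤ ‖x - y‖ ^ 2 → M ≤ u x * (‖x - y‖ ^ 2) ^ α)
    (A : ℝ) (hA : 1 ≤ A) :
    ∃ l, 0 < l ∧ (∃ x₀, l = u x₀ * (A + ‖x₀ - y‖ ^ 2) ^ α) ∧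
      u y ^ (p - 1 - 1 / α) ≤ 2 * k * α * l ^ (-(1 / α)) := by
  have hα0 : 0 < α := by
    have : (2:ℝ) < k := by exact_mod_cast hk
    linarith
  have hA0 : 0 < A := by linarith
  have hTpos : ∀ x, 0 < A + ‖x - y‖ ^ 2 := fun x => by positivity
  set G : EuclideanSpace ℝ (Fin N) → ℝ := fun x => u x * (A + ‖x - y‖ ^ 2) ^ α with hG
  have hrc : ∀ β : ℝ, Continuous (fun x : EuclideanSpace ℝ (Fin N) => (A + ‖x - y‖ ^ 2) ^ β) := by
    intro β
    refine Continuous.rpow_const (by fun_prop) (fun x => Or.inl (hTpos x).ne')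
  have hinv : ∀ x, (A + ‖x - y‖ ^ 2) ^ (-α) * (A + ‖x - y‖ ^ 2) ^ α = 1 := by
    intro x
    rw [← Real.rpow_add (hTpos x)]; simp
  have hGl : LowerSemicontinuous G := by
    intro x t ht
    have hl : LowerSemicontinuous (fun x => u x + -(t * (A + ‖x - y‖ ^ 2) ^ (-α))) :=
      hlsc.add ((continuous_const.mul (hrc (-α))).neg.lowerSemicontinuous)
    have hpt : ∀ z, t < G z ↔ 0 < u z + -(t * (A + ‖z - y‖ ^ 2) ^ (-α)) := by
      intro z
      have h1 := hinv z
      have h2 : 0 < (A + ‖z - y‖ ^ 2) ^ α := Real.rpow_pos_of_pos (hTpos z) _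
      have h3 : G z - t = (u z + -(t * (A + ‖z - y‖ ^ 2) ^ (-α))) * (A + ‖z - y‖ ^ 2) ^ α := by
        simp only [hG]
        linear_combination t * h1
      rw [← sub_pos, h3, mul_pos_iff_of_pos_right h2]
    filter_upwards [hl x 0 ((hpt x).1 ht)] with z hz using (hpt z).2 hz
  obtain ⟨R, hR⟩ := hcoer (G y)
  obtain ⟨x₀, hx₀, hmin⟩ := (hGl.lowerSemicontinuousOn _).exists_isMinOn
    (s := Metric.closedBall y (|R| + 1)) ⟨y, by simp; positivity⟩ (isCompact_closedBall _ _)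
  have hy : G x₀ ≤ G y := hmin (by simp; positivity)
  have hglob : ∀ x, G x₀ ≤ G x := by
    intro x
    by_cases hx : x ∈ Metric.closedBall y (|R| + 1)
    · exact hmin hx
    · simp [dist_eq_norm] at hx
      have hr : R ≤ ‖x - y‖ ^ 2 := by nlinarith [abs_nonneg R, le_abs_self R]
      have h1 := hR x hr
      have h2 : (‖x - y‖ ^ 2) ^ α ≤ (A + ‖x - y‖ ^ 2) ^ α :=
        Real.rpow_le_rpow (by positivity) (by linarith) hα0.le
      have h3 : G x₀ ≤ u x * (‖x - y‖ ^ 2) ^ α := hy.trans h1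
      exact h3.trans (mul_le_mul_of_nonneg_left h2 (hpos x).le)
  set l := G x₀ with hl
  have hl0 : 0 < l := mul_pos (hpos _) (Real.rpow_pos_of_pos (hTpos _) _)
  refine ⟨l, hl0, ⟨x₀, rfl⟩, ?_⟩
  set s := ‖x₀ - y‖ ^ 2 with hsdef
  have hs0 : 0 ≤ s := by positivity
  have hT0 : 0 < A + s := hTpos x₀
  have hder : ∀ (β K t : ℝ), 0 < A + t → HasDerivAt (fun t : ℝ => K * (A + t) ^ β)
      (K * β * (A + t) ^ (β - 1)) t := by
    intro β K t ht
    have := ((hasDerivAt_pow' ht β).comp t ((hasDerivAt_id t).const_add A)).const_mul K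
    refine this.congr_deriv ?_
    ring
  have hmin2 : IsLocalMin (fun x => u x - (fun t => l * (A + t) ^ (-α)) (‖x - y‖ ^ 2)) x₀ := by
    refine Eventually.of_forall fun x => ?_
    have h1 : ∀ z, u z = G z * (A + ‖z - y‖ ^ 2) ^ (-α) := by
      intro z
      have := hinv z
      simp only [hG]
      linear_combination (- u z) * this
    show u x₀ - l * _ ≤ u x - l * _
    rw [h1 x₀, h1 x, ← hl]
    have := mul_le_mul_of_nonneg_right (hglob x)
      (Real.rpow_pos_of_pos (hTpos x) (-α)).le
    linarith
  have hT := test_radial (by omega) hkN hsuper y x₀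
        (fun t : ℝ => l * (A + t) ^ (-α)) _ _ s hsdef
    (by
      have e1 : ContDiffAt ℝ 2 (fun t : ℝ => (A + t) ^ (-α)) s :=
        (contDiffAt_const.add contDiffAt_id).rpow_const_of_ne hT0.ne'
      exact contDiffAt_const.mul e1)
    (by
      have : ∀ᶠ t in 𝓝 s, -A < t := lt_mem_nhds (by linarith)
      filter_upwards [this] with t ht using hder (-α) l t (by linarith))
    (hder (-α - 1) (l * -α) s hT0)
    (by
      have : 0 < (A + s) ^ (-α - 1 - 1) := by positivity
      have e : l * -α * (-α - 1) * (A + s) ^ (-α - 1 - 1)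
        = l * α * (α + 1) * (A + s) ^ (-α - 1 - 1) := by ring
      rw [e]; positivity) hmin2
  set T := A + s with hTdef
  set v := u x₀ with hv
  have hv0 : 0 < v := hpos x₀
  have hlv : l = v * T ^ α := rfl
  have p1 : T ^ (-α - 1) = T ^ (-α - 1 - 1) * T := by
    rw [← Real.rpow_add_one hT0.ne']; congr 1; ring
  have e : 2 * (k:ℝ) * (l * -α * T ^ (-α - 1))
      + 4 * s * (l * -α * (-α - 1) * T ^ (-α - 1 - 1))
      = -(2 * k * α * l * A * T ^ (-α - 1 - 1)) := by
    rw [p1, hα, hTdef]; ring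
  rw [e] at hT
  have hlT : l * T ^ (-α - 1 - 1) * T = v * T⁻¹ := by
    rw [mul_assoc, ← p1, hlv, mul_assoc, ← Real.rpow_add hT0]
    rw [show α + (-α - 1) = -1 by ring, Real.rpow_neg_one]
  have hk0 : (0:ℝ) < k := by rw [hα]; linarith
  have hT2 : v ^ p ≤ 2 * k * α * (v * T⁻¹) := by
    have h1 : A ≤ T := by linarith
    have h2 : 0 < 2 * k * α * (l * T ^ (-α - 1 - 1)) := by positivity
    rw [← hlT]
    nlinarith
  have hTi : T⁻¹ = v ^ (1 / α) * l ^ (-(1 / α)) := by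
    have : l ^ (-(1 / α)) = v ^ (-(1 / α)) * T⁻¹ := by
      rw [hlv, Real.mul_rpow hv0.le (by positivity), ← Real.rpow_mul hT0.le]
      rw [show α * (-(1 / α)) = -1 by field_simp, Real.rpow_neg_one]
    rw [this, ← mul_assoc, ← Real.rpow_add hv0]; simp
  have hvU : v ≤ u y := by
    have h1 : v * T ^ α ≤ u y * A ^ α := by
      have := hy
      simp only [hG] at this
      simpa using this
    have h2 : A ^ α ≤ T ^ α := Real.rpow_le_rpow hA0.le (by linarith) hα0.le
    have h3 : 0 < T ^ α := by positivity
    have h4 := hpos y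
    by_contra! hcon
    nlinarith
  have hexp : p - 1 - 1 / α ≤ 0 := by
    have : p ≤ (α + 1) / α := by rw [le_div_iff₀ hα0]; linarith
    have e2 : (α + 1) / α = 1 + 1 / α := by field_simp
    linarith
  have h5 : u y ^ (p - 1 - 1 / α) ≤ v ^ (p - 1 - 1 / α) :=
    Real.rpow_le_rpow_of_nonpos hv0 hvU hexp
  refine h5.trans ?_
  rw [hTi] at hT2
  rw [Real.rpow_sub hv0, Real.rpow_sub hv0, Real.rpow_one, div_div, div_le_iff₀ (by positivity)]
  linarith

theorem statement6 (N k : ℕ) (hk2 : 2 < k) (hkN : k < N) (p : ℝ) (hp0 : 0 < p)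
    (hp : p ≤ (k : ℝ) / ((k : ℝ) - 2))
    (u : EuclideanSpace ℝ (Fin N) → ℝ) (hnn : ∀ x, 0 ≤ u x)
    (hlsc : LowerSemicontinuous u)
    (hsuper : IsViscositySupersolution (Pplus k) (fun t => t ^ p) Set.univ u) :
    ∀ x, u x = 0 := by
  intro y
  by_contra hne
  have hy : 0 < u y := lt_of_le_of_ne (hnn y) (Ne.symm hne)
  have hk2' : (2:ℝ) < k := by exact_mod_cast hk2
  obtain ⟨α, hα⟩ : ∃ α : ℝ, (k:ℝ) = 2 * α + 2 := ⟨((k:ℝ) - 2) / 2, by ring⟩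
  have hα0 : 0 < α := by linarith
  have hpα : α * p ≤ α + 1 := by
    rw [hα, le_div_iff₀ (by linarith)] at hp
    linarith
  -- positivity on a small ball
  obtain ⟨r, hr, hball⟩ := Metric.eventually_nhds_iff_ball.1 (hlsc y (u y / 2) (by linarith))
  set s0 := (r / 2) ^ 2 with hs0
  have hs0p : 0 < s0 := by positivity
  have hum : ∀ x, ‖x - y‖ ^ 2 ≤ s0 → u y / 2 ≤ u x := by
    intro x hx
    have : ‖x - y‖ ≤ r / 2 := (pow_le_pow_iff_left₀ (norm_nonneg _) (by positivity) two_ne_zero).1 hx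
    exact (hball x (by rw [Metric.mem_ball, dist_eq_norm]; linarith)).le
  obtain ⟨c, hc, hA⟩ := stepA hk2 hkN.le hα hnn hlsc hsuper y s0 (u y / 2) hs0p (by linarith) hum
  have hpos : ∀ x, 0 < u x := by
    intro x
    rcases le_total (‖x - y‖ ^ 2) s0 with h | h
    · linarith [hum x h]
    · have h1 : 0 < ‖x - y‖ ^ 2 := lt_of_lt_of_le hs0p h
      exact lt_of_lt_of_le (by positivity) (hA x h)
  obtain ⟨ε, s1, hε, hs1, hB⟩ := stepB hk2 hkN.le hα hp0 hpα hnn hlsc hsuper y s0 c hc hA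
  have hcoer : ∀ M : ℝ, ∃ R : ℝ, 0 < R ∧ ∀ x, R ≤ ‖x - y‖ ^ 2 → M ≤ u x * (‖x - y‖ ^ 2) ^ α := by
    intro M
    refine ⟨max s1 (Real.exp (M / ε)), lt_of_lt_of_le (by linarith) (le_max_left _ _), ?_⟩
    intro x hx
    have h1 := hB x ((le_max_left _ _).trans hx)
    set s := ‖x - y‖ ^ 2 with hs
    have hsp : 0 < s := lt_of_lt_of_le (by linarith) ((le_max_left _ _).trans hx)
    have h2 : M / ε ≤ Real.log s := by
      rw [Real.le_log_iff_exp_le hsp]; exact (le_max_right _ _).trans hx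
    rw [div_le_iff₀ hε] at h2
    have h3 : s ^ (-α) * s ^ α = 1 := by rw [← Real.rpow_add hsp]; simp
    have h4 := mul_le_mul_of_nonneg_right h1 (Real.rpow_pos_of_pos hsp α).le
    have h5 : ε * (s ^ (-α) * Real.log s) * s ^ α = ε * Real.log s := by
      linear_combination (ε * Real.log s) * h3
    linarith
  -- the bound on l
  have hU : 0 < u y ^ (p - 1 - 1 / α) := by positivity
  have hlim : Tendsto (fun l : ℝ => 2 * k * α * l ^ (-(1 / α))) atTop (𝓝 0) := by
    have := (tendsto_rpow_neg' (β := -(1 / α)) (by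
      have : 0 < 1 / α := by positivity
      linarith)).const_mul (2 * k * α)
    simpa using this
  obtain ⟨M, hM⟩ := eventually_atTop.1 (hlim.eventually (gt_mem_nhds hU))
  -- choose A large so that l ≥ M
  obtain ⟨R, hR0, hR⟩ := hcoer M
  obtain ⟨x1, hx1, hmin⟩ := (hlsc.lowerSemicontinuousOn _).exists_isMinOn
    (s := Metric.closedBall y (R + 1)) ⟨y, by simp; positivity⟩ (isCompact_closedBall _ _)
  have hm : 0 < u x1 := hpos x1
  obtain ⟨A, hA1, hAM⟩ : ∃ A : ℝ, 1 ≤ A ∧ M / u x1 ≤ A ^ α := by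
    obtain ⟨A, h1, h2⟩ := ((eventually_ge_atTop 1).and
      ((tendsto_rpow_atTop hα0).eventually_ge_atTop (M / u x1))).exists
    exact ⟨A, h1, h2⟩
  obtain ⟨l, hl0, ⟨x₀, hx₀⟩, hl⟩ := stepC hk2 hkN.le hα hpα hlsc hsuper y hpos
    (fun M => (hcoer M).imp fun _ h => h.2) A hA1
  have hlM : M ≤ l := by
    rw [hx₀]
    by_cases h : R ≤ ‖x₀ - y‖ ^ 2
    · refine (hR x₀ h).trans ?_
      exact mul_le_mul_of_nonneg_left
        (Real.rpow_le_rpow (by positivity) (by linarith) hα0.le) (hpos _).le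
    · have hb : x₀ ∈ Metric.closedBall y (R + 1) := by
        rw [Metric.mem_closedBall, dist_eq_norm]
        nlinarith [norm_nonneg (x₀ - y)]
      have h1 : u x1 ≤ u x₀ := hmin hb
      rw [div_le_iff₀ hm] at hAM
      have h2 : A ^ α ≤ (A + ‖x₀ - y‖ ^ 2) ^ α :=
        Real.rpow_le_rpow (by linarith) (by nlinarith [sq_nonneg ‖x₀ - y‖]) hα0.le
      calc M ≤ A ^ α * u x1 := hAM
        _ = u x1 * A ^ α := mul_comm _ _
        _ ≤ u x₀ * (A + ‖x₀ - y‖ ^ 2) ^ α := by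
          apply mul_le_mul h1 h2 (by positivity) (hpos _).le
  have := hM l hlM
  linarith
end

section
/- Let N and k be positive integers with k < N, let p > 0, and let u ∈ C²([0,∞)) be positive, satisfy u′(0) = 0, u′(r) ≤ 0 for all r ≥ 0, and solve u″(r) + (k−1)u′(r)/r = −u(r)^p for all r > 0. Then u″(r) ≥ u′(r)/r for all r > 0, and consequently the radial function v(x) = u(|x|) is C² on ℝ^N and satisfies P⁺_k(D²v(x)) + v(x)^p = 0 for every x ∈ ℝ^N. -/
open scoped BigOperators

open Filter Topology

theorem aux_Pplus {N k : ℕ} (hk : 0 < k) (hkN : k < N) (a c : ℝ) (hc : 0 ≤ c)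
    (e : Fin N → ℝ) (he : c = 0 ∨ ∑ i, e i * e i = 1) (H : Matrix (Fin N) (Fin N) ℝ)
    (hH : ∀ i j, H i j = (if i = j then a else 0) + c * (e i * e j)) :
    Pplus k H = k * a + c := by
  have hHerm : H.IsHermitian := by
    ext i j
    simp only [Matrix.conjTranspose_apply, hH, star_trivial, eq_comm (a := i) (b := j)]
    ring
  have htr : ∑ i, hHerm.eigenvalues i = N * a + c := by
    have h1 := hHerm.trace_eq_sum_eigenvalues
    simp only [RCLike.ofReal_real_eq_id, id_eq] at h1
    rw [← h1, Matrix.trace]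
    simp only [Matrix.diag_apply, hH, if_true, Finset.sum_add_distrib, ← Finset.mul_sum]
    rcases he with he | he
    · simp [he]
    · simp [he]
  have hev : ∀ i, hHerm.eigenvalues i = a ∨ hHerm.eigenvalues i = a + c := by
    intro i
    set l := hHerm.eigenvalues i with hl
    set v : Fin N → ℝ := ⇑(hHerm.eigenvectorBasis i) with hv
    have hmv : H.mulVec v = l • v := hHerm.mulVec_eigenvectorBasis i
    have hv0 : v ≠ 0 := by
      intro h
      apply hHerm.eigenvectorBasis.orthonormal.ne_zero i
      ext j
      exact congrFun h j
    set s := ∑ j, e j * v j with hs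
    have hcoord : ∀ j, (l - a) * v j = c * s * e j := by
      intro j
      have := congrFun hmv j
      simp only [Matrix.mulVec, dotProduct, hH, Pi.smul_apply, smul_eq_mul, add_mul, ite_mul,
        zero_mul, Finset.sum_add_distrib, Finset.sum_ite_eq, Finset.mem_univ, if_true] at this
      have h2 : ∑ x, c * (e j * e x) * v x = c * s * e j := by
        rw [hs, Finset.mul_sum, Finset.sum_mul]
        exact Finset.sum_congr rfl fun x _ => by ring
      rw [h2] at this
      linarith
    by_cases hcs : c * s = 0
    · left
      obtain ⟨j, hj⟩ := Function.ne_iff.mp hv0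
      have := hcoord j
      rw [hcs, zero_mul] at this
      rcases mul_eq_zero.mp this with h | h
      · linarith
      · exact absurd h hj
    · right
      have hc0 : c ≠ 0 := fun h => hcs (by simp [h])
      have hs0 : s ≠ 0 := fun h => hcs (by simp [h])
      have he' := he.resolve_left hc0
      have : (l - a) * s = c * s := by
        calc (l - a) * s = ∑ j, e j * ((l - a) * v j) := by
              rw [hs, Finset.mul_sum]
              exact Finset.sum_congr rfl fun x _ => by ring
          _ = ∑ j, (c * s) * (e j * e j) := Finset.sum_congr rfl fun x _ => by
              rw [hcoord]; ring
          _ = c * s := by rw [← Finset.mul_sum, he', mul_one]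
      have := mul_right_cancel₀ hs0 this
      linarith
  set f := sortedEig H with hf
  have hfeq : f = hHerm.eigenvalues ∘ Tuple.sort hHerm.eigenvalues := by
    rw [hf, sortedEig, dif_pos hHerm]
  have hmono : Monotone f := by rw [hfeq]; exact Tuple.monotone_sort _
  have hfev : ∀ i, f i = a ∨ f i = a + c := fun i => by rw [hfeq]; exact hev _
  have hfsum : ∑ i, f i = N * a + c := by
    rw [hfeq, ← htr]
    exact Equiv.sum_comp (Tuple.sort hHerm.eigenvalues) hHerm.eigenvalues
  have hd0 : ∀ i, 0 ≤ f i - a := fun i => by rcases hfev i with h | h <;> linarith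
  have hdsum : ∑ i, (f i - a) = c := by
    rw [Finset.sum_sub_distrib, hfsum]; simp
  have hlow : ∀ i : Fin N, (i : ℕ) < N - k → f i - a = 0 := by
    intro i hi
    let m : Fin N := ⟨N - 1, by omega⟩
    have him : i ≠ m := by
      intro h
      have := congrArg Fin.val h
      simp only [m] at this
      omega
    have hle : f i ≤ f m := hmono (Fin.le_def.mpr (by simp only [m]; omega))
    have h2 : (f i - a) + (f m - a) ≤ c := by
      rw [← hdsum, ← Finset.sum_pair him (f := fun i => f i - a)]
      exact Finset.sum_le_sum_of_subset_of_nonneg (Finset.subset_univ _) fun j _ _ => hd0 j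
    rcases hfev i with h | h
    · linarith
    · linarith
  have hcard : ∑ i : Fin N, (if N - k ≤ (i : ℕ) then a else 0) = k * a := by
    rw [Fin.sum_univ_eq_sum_range (fun i => if N - k ≤ i then a else 0) N]
    rw [show N = (N - k) + k by omega, Finset.sum_range_add, Nat.add_sub_cancel]
    rw [Finset.sum_eq_zero, Finset.sum_congr rfl (g := fun _ => a)]
    · simp
    · intro x _
      simp
    · intro x hx
      simp only [Finset.mem_range] at hx
      rw [if_neg (by omega)]
  rw [Pplus, ← hcard, ← hdsum, ← Finset.sum_add_distrib]
  refine Finset.sum_congr rfl fun i _ => ?_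
  by_cases h : N - k ≤ (i : ℕ)
  · simp [h, ← hf]
  · rw [if_neg h, if_neg h, hlow i (by omega)]; simp

section radial
variable {E : Type*} [NormedAddCommGroup E] [InnerProductSpace ℝ E]

/-- The real inner product as a bilinear continuous map. -/
noncomputable def auxL : E →L[ℝ] E →L[ℝ] ℝ := innerSL ℝ

@[simp] theorem auxL_apply (x : E) : auxL x = innerSL ℝ x := rfl

theorem aux_cont_add {F : Type*} [NormedAddCommGroup F] [NormedSpace ℝ F] {f g : E → (E →L[ℝ] F)}
    (hf : Continuous f) (hg : Continuous g) : Continuous (fun x => f x + g x) := hf.add hg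

theorem aux_cont_smul {F : Type*} [NormedAddCommGroup F] [NormedSpace ℝ F] {q : E → ℝ}
    {B : E → (E →L[ℝ] F)} (hq : Continuous q) (hq0 : q 0 = 0) (hB : ∀ x, ‖B x‖ ≤ 1)
    (hBc : ∀ x, x ≠ 0 → ContinuousAt B x) : Continuous (fun x => q x • B x) := by
  rw [continuous_iff_continuousAt]
  intro x
  by_cases hx : x = 0
  · subst hx
    rw [ContinuousAt, hq0, zero_smul]
    have ht : Tendsto (fun x : E => |q x|) (𝓝 0) (𝓝 0) := by
      simpa [hq0] using (hq.tendsto 0).abs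
    refine squeeze_zero_norm (fun x => ?_) ht
    rw [norm_smul, Real.norm_eq_abs]
    exact mul_le_of_le_one_right (abs_nonneg _) (hB x)
  · exact hq.continuousAt.smul (hBc x hx)

theorem aux_norm {x : E} (hx : x ≠ 0) :
    HasFDerivAt (fun y : E => ‖y‖) (‖x‖⁻¹ • innerSL ℝ x) x := by
  have h := (hasStrictFDerivAt_norm_sq x).hasFDerivAt.sqrt (by simpa using hx)
  simp only [Real.sqrt_sq (norm_nonneg _)] at h
  convert h using 1
  ext y
  simp
  field_simp

theorem aux_phi_cont {u' u'' : ℝ → ℝ}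
    (hu'' : ∀ r ∈ Set.Ici (0 : ℝ), HasDerivWithinAt u' (u'' r) (Set.Ici 0) r) (h0 : u' 0 = 0) :
    ContinuousOn (Function.update (fun r => u' r / r) 0 (u'' 0)) (Set.Ici 0) := by
  intro r hr
  rcases eq_or_lt_of_le (show (0:ℝ) ≤ r from hr) with h | h
  · subst h
    rw [continuousWithinAt_update_same]
    have := hasDerivWithinAt_iff_tendsto_slope.mp (hu'' 0 hr)
    refine this.congr fun r => ?_
    simp [slope_def_field, h0]
  · rw [continuousWithinAt_update_of_ne h.ne']
    exact (hu'' r hr).continuousWithinAt.div continuousWithinAt_id h.ne'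

theorem aux_comp_norm {E : Type*} [NormedAddCommGroup E] {f : ℝ → ℝ} (hf : ContinuousOn f (Set.Ici 0)) :
    Continuous (fun x : E => f ‖x‖) :=
  hf.comp_continuous continuous_norm fun x => norm_nonneg x

theorem aux_first {u u' u'' : ℝ → ℝ}
    (hu' : ∀ r ∈ Set.Ici (0 : ℝ), HasDerivWithinAt u (u' r) (Set.Ici 0) r) (h0 : u' 0 = 0)
    (x : E) :
    HasFDerivAt (fun y : E => u ‖y‖)
      ((Function.update (fun r => u' r / r) 0 (u'' 0)) ‖x‖ • innerSL ℝ x) x := by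
  by_cases hx : x = 0
  · subst hx
    simp only [map_zero, smul_zero]
    have h := hu' 0 Set.self_mem_Ici
    rw [h0, hasDerivWithinAt_iff_isLittleO] at h
    have ht : Tendsto (fun y : E => ‖y‖) (𝓝 0) (𝓝[Set.Ici 0] 0) :=
      tendsto_nhdsWithin_iff.mpr ⟨by simpa using (continuous_norm (E := E)).tendsto 0,
        Eventually.of_forall fun y => norm_nonneg y⟩
    have h2 := h.comp_tendsto ht
    rw [hasFDerivAt_iff_isLittleO_nhds_zero]
    have h3 := h2.norm_right
    simp only [Function.comp_def, sub_zero, smul_zero, norm_norm] at h3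
    have h4 := h3.of_norm_right
    simpa using h4
  · have hr : 0 < ‖x‖ := norm_pos_iff.mpr hx
    have hd := (hu' ‖x‖ hr.le).hasDerivAt (Ici_mem_nhds hr)
    have := hd.comp_hasFDerivAt x (aux_norm hx)
    rw [Function.update_of_ne hr.ne', div_eq_mul_inv, mul_smul]
    exact this

set_option synthInstance.maxHeartbeats 200000 in
theorem aux_second {u' u'' : ℝ → ℝ}
    (hu'' : ∀ r ∈ Set.Ici (0 : ℝ), HasDerivWithinAt u' (u'' r) (Set.Ici 0) r) (h0 : u' 0 = 0)
    (x : E) :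
    HasFDerivAt (fun y : E => (Function.update (fun r => u' r / r) 0 (u'' 0)) ‖y‖ • innerSL ℝ y)
      ((Function.update (fun r => u' r / r) 0 (u'' 0)) ‖x‖ • auxL (E := E) +
        (u'' ‖x‖ - (Function.update (fun r => u' r / r) 0 (u'' 0)) ‖x‖) •
          (‖x‖⁻¹ • innerSL ℝ x).smulRight (‖x‖⁻¹ • innerSL ℝ x)) x := by
  have hc := aux_comp_norm (E := E) (aux_phi_cont hu'' h0)
  set φ := Function.update (fun r => u' r / r) 0 (u'' 0) with hφ
  by_cases hx : x = 0
  · subst hx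
    have h1 : φ 0 = u'' 0 := by simp [hφ]
    rw [hasFDerivAt_iff_isLittleO_nhds_zero]
    have h2 : (fun y : E => φ ‖y‖ - φ 0) =o[𝓝 0] (fun _ => (1 : ℝ)) := by
      rw [Asymptotics.isLittleO_one_iff]
      have := (hc.tendsto 0).sub_const (φ 0)
      simpa using this
    have h3 : (fun y : E => innerSL ℝ y) =O[𝓝 0] (fun y : E => y) :=
      ContinuousLinearMap.isBigO_id (auxL (E := E)) _
    have h4 := h2.smul_isBigO h3
    simp only [one_smul] at h4
    refine h4.congr_left fun y => ?_
    ext z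
    simp [h1, sub_mul]
  · have hr : 0 < ‖x‖ := norm_pos_iff.mpr hx
    have hd := ((hu'' ‖x‖ hr.le).hasDerivAt (Ici_mem_nhds hr)).div (hasDerivAt_id _) hr.ne'
    have hd2 : HasDerivAt φ ((u'' ‖x‖ * id ‖x‖ - u' ‖x‖ * 1) / id ‖x‖ ^ 2) ‖x‖ := by
      refine hd.congr_of_eventuallyEq ?_
      filter_upwards [eventually_ne_nhds hr.ne'] with r hr'
      rw [hφ, Function.update_of_ne hr']
      rfl
    have h3 := (hd2.comp_hasFDerivAt x (aux_norm hx)).smul ((auxL (E := E)).hasFDerivAt (x := x))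
    have h4 : φ ‖x‖ = u' ‖x‖ / ‖x‖ := by rw [hφ, Function.update_of_ne hr.ne']
    refine h3.congr_fderiv ?_
    ext y z
    simp [h4]
    field_simp

set_option synthInstance.maxHeartbeats 200000 in
theorem aux_second_cont {u' u'' : ℝ → ℝ}
    (hu'' : ∀ r ∈ Set.Ici (0 : ℝ), HasDerivWithinAt u' (u'' r) (Set.Ici 0) r)
    (hc'' : ContinuousOn u'' (Set.Ici 0)) (h0 : u' 0 = 0) :
    Continuous (fun x : E => 
      ((Function.update (fun r => u' r / r) 0 (u'' 0)) ‖x‖ • auxL (E := E) +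
        (u'' ‖x‖ - (Function.update (fun r => u' r / r) 0 (u'' 0)) ‖x‖) •
          (‖x‖⁻¹ • innerSL ℝ x).smulRight (‖x‖⁻¹ • innerSL ℝ x))) := by
  have hc := aux_comp_norm (E := E) (aux_phi_cont hu'' h0)
  have hc2 := aux_comp_norm (E := E) hc''
  set φ := Function.update (fun r => u' r / r) 0 (u'' 0) with hφ
  have hfst : Continuous (fun x : E => φ ‖x‖ • auxL (E := E)) := hc.smul continuous_const
  refine aux_cont_add hfst ?_
  have hd := hc2.sub hc
  refine aux_cont_smul (F := E →L[ℝ] ℝ) hd (by simp [hφ]) (fun x => ?_) (fun x hx => ?_)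
  · rw [ContinuousLinearMap.norm_smulRight_apply]
    have : ‖‖x‖⁻¹ • innerSL ℝ x‖ ≤ 1 := by
      rw [norm_smul, innerSL_apply_norm, norm_inv, norm_norm]
      exact inv_mul_le_one
    exact mul_le_one₀ this (norm_nonneg _) this
  · have h6 : ContinuousAt (fun x : E => ‖x‖⁻¹ • innerSL ℝ x) x :=
      (continuous_norm.continuousAt.inv₀ (norm_ne_zero_iff.mpr hx)).smul
        (auxL (E := E)).continuous.continuousAt
    exact ((ContinuousLinearMap.smulRightL ℝ E
      (E →L[ℝ] ℝ)).continuous.continuousAt.comp h6).clm_apply h6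

end radial

theorem aux_ineq {k : ℕ} (hk : 0 < k) {p : ℝ} (hp : 0 < p)
    {u u' u'' : ℝ → ℝ}
    (hu' : ∀ r ∈ Set.Ici (0 : ℝ), HasDerivWithinAt u (u' r) (Set.Ici 0) r)
    (hu'' : ∀ r ∈ Set.Ici (0 : ℝ), HasDerivWithinAt u' (u'' r) (Set.Ici 0) r)
    (hpos : ∀ r ∈ Set.Ici (0 : ℝ), 0 < u r)
    (h0 : u' 0 = 0)
    (hdec : ∀ r ∈ Set.Ici (0 : ℝ), u' r ≤ 0)
    (heq : ∀ r : ℝ, 0 < r → u'' r + ((k : ℝ) - 1) * u' r / r = -(u r ^ p)) (r : ℝ) (hr : 0 < r) :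
    u' r / r ≤ u'' r := by
  have hanti : AntitoneOn u (Set.Ici 0) := by
    refine antitoneOn_of_hasDerivWithinAt_nonpos (convex_Ici 0) (f' := u')
      (fun s hs => (hu' s hs).continuousWithinAt)
      (fun s hs => (hu' s (interior_subset hs)).mono interior_subset)
      (fun s hs => hdec s (interior_subset hs))
  obtain ⟨m, rfl⟩ : ∃ m, k = m + 1 := ⟨k - 1, by omega⟩
  have hg : AntitoneOn (fun s => s ^ m * u' s + u r ^ p * (s ^ (m + 1) / (m + 1)))
      (Set.Icc 0 r) := by
    refine antitoneOn_of_hasDerivWithinAt_nonpos (convex_Icc 0 r)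
      (f' := fun s => s ^ m * (u r ^ p - u s ^ p)) ?_ ?_ ?_
    · have : ContinuousOn u' (Set.Icc 0 r) := fun s hs =>
        ((hu'' s hs.1).continuousWithinAt).mono Set.Icc_subset_Ici_self
      fun_prop
    · intro s hs
      rw [interior_Icc] at hs
      have hd := (hu'' s hs.1.le).hasDerivAt (Ici_mem_nhds hs.1)
      have h1 := ((hasDerivAt_pow m s).mul hd).add
        (((hasDerivAt_pow (m + 1) s).div_const ((m : ℝ) + 1)).const_mul (u r ^ p))
      refine HasDerivAt.hasDerivWithinAt ?_
      refine h1.congr_deriv ?_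
      have he := heq s hs.1
      have hs0 := hs.1.ne'
      have hm : ((m : ℝ) + 1) ≠ 0 := by positivity
      have : u'' s = -(u s ^ p) - m * u' s / s := by
        push_cast at he
        rw [← he]; ring
      rw [this]
      rcases m with _ | m
      · simp; ring
      · simp only [Nat.add_sub_cancel]
        push_cast
        push_cast at hm
        field_simp
        ring
    · intro s hs
      rw [interior_Icc] at hs
      have : u r ^ p ≤ u s ^ p := Real.rpow_le_rpow (hpos r hr.le).le
        (hanti hs.1.le hr.le hs.2.le) hp.le
      exact mul_nonpos_of_nonneg_of_nonpos (pow_nonneg hs.1.le _) (by linarith)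
  have h1 := hg (Set.left_mem_Icc.mpr hr.le) (Set.right_mem_Icc.mpr hr.le) hr.le
  simp only [h0, mul_zero, ne_eq, Nat.add_eq_zero_iff, one_ne_zero, and_false,
    not_false_eq_true, zero_pow, zero_div, add_zero] at h1
  have hm : (0 : ℝ) < (m : ℝ) + 1 := by positivity
  have hrm : 0 < r ^ m := pow_pos hr m
  have h2 : u' r + u r ^ p * (r / (m + 1)) ≤ 0 := by
    by_contra hcon
    push Not at hcon
    have := mul_pos hrm hcon
    rw [pow_succ] at h1
    have e : r ^ m * u' r + u r ^ p * (r ^ m * r / (m + 1)) =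
      r ^ m * (u' r + u r ^ p * (r / (m + 1))) := by ring
    linarith
  have h3 : u r ^ p ≤ -((m + 1) * (u' r / r)) := by
    have e : u r ^ p = (u r ^ p * (r / (m + 1))) * ((m + 1) / r) := by
      field_simp
    have e2 : -((m + 1) * (u' r / r)) = (- u' r) * ((m + 1) / r) := by ring
    rw [e, e2]
    exact mul_le_mul_of_nonneg_right (by linarith) (by positivity)
  have he := heq r hr
  push_cast at he
  have e3 : ((m : ℝ) + 1 - 1) * u' r / r = m * (u' r / r) := by ring
  rw [e3] at he
  linarith

theorem statement9 (N k : ℕ) (hk : 0 < k) (hkN : k < N) (p : ℝ) (hp : 0 < p)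
    (u u' u'' : ℝ → ℝ)
    (hu' : ∀ r ∈ Set.Ici (0 : ℝ), HasDerivWithinAt u (u' r) (Set.Ici 0) r)
    (hu'' : ∀ r ∈ Set.Ici (0 : ℝ), HasDerivWithinAt u' (u'' r) (Set.Ici 0) r)
    (hu''cont : ContinuousOn u'' (Set.Ici 0))
    (hpos : ∀ r ∈ Set.Ici (0 : ℝ), 0 < u r)
    (h0 : u' 0 = 0)
    (hdec : ∀ r ∈ Set.Ici (0 : ℝ), u' r ≤ 0)
    (heq : ∀ r : ℝ, 0 < r → u'' r + ((k : ℝ) - 1) * u' r / r = -(u r ^ p)) :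
    (∀ r : ℝ, 0 < r → u' r / r ≤ u'' r) ∧
    ContDiff ℝ 2 (fun x : EuclideanSpace ℝ (Fin N) => u ‖x‖) ∧
    ∀ x : EuclideanSpace ℝ (Fin N),
      Pplus k (hessianMatrix (fun y => u ‖y‖) x) + u ‖x‖ ^ p = 0 := by
  have hineq := aux_ineq hk hp hu' hu'' hpos h0 hdec heq
  have hA := aux_first (E := EuclideanSpace ℝ (Fin N)) (u'' := u'') hu' h0
  have hB := aux_second (E := EuclideanSpace ℝ (Fin N)) hu'' h0
  have hC := aux_second_cont (E := EuclideanSpace ℝ (Fin N)) hu'' hu''cont h0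
  have hφc := aux_phi_cont hu'' h0
  have hφ0 : Function.update (fun r => u' r / r) 0 (u'' 0) 0 = u'' 0 := by simp
  have hφ1 : ∀ r, 0 < r → Function.update (fun r => u' r / r) 0 (u'' 0) r = u' r / r :=
    fun r hr => Function.update_of_ne hr.ne' _ _
  generalize Function.update (fun r => u' r / r) 0 (u'' 0) = φ at *
  refine ⟨hineq, ?_, ?_⟩
  · have h1 := (contDiff_succ_iff_hasFDerivAt (𝕜 := ℝ) (n := 1)
      (f := fun x : EuclideanSpace ℝ (Fin N) => u ‖x‖)).mpr
      ⟨_, by exact_mod_cast contDiff_one_iff_hasFDerivAt.mpr ⟨_, hC, hB⟩, hA⟩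
    exact_mod_cast h1
  · intro x
    have hode : ∀ r ∈ Set.Ici (0 : ℝ), u'' r + ((k : ℝ) - 1) * φ r + u r ^ p = 0 := by
      have hcu : ContinuousOn u (Set.Ici 0) := fun s hs => (hu' s hs).continuousWithinAt
      have hcont : ContinuousOn (fun r => u'' r + ((k : ℝ) - 1) * φ r + u r ^ p) (Set.Ici 0) :=
        (hu''cont.add (continuousOn_const.mul hφc)).add
          (hcu.rpow_const fun s hs => Or.inl (hpos s hs).ne')
      have hE : Set.EqOn (fun r => u'' r + ((k : ℝ) - 1) * φ r + u r ^ p) (fun _ => 0)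
          (Set.Ioi 0) := by
        intro r hr
        have := heq r hr
        simp only [hφ1 r hr]
        rw [mul_div_assoc] at this
        linarith
      exact hE.of_subset_closure hcont continuousOn_const Set.Ioi_subset_Ici_self
        (by rw [closure_Ioi])
    have hfd : fderiv ℝ (fun y : EuclideanSpace ℝ (Fin N) => u ‖y‖) =
        fun y => φ ‖y‖ • innerSL ℝ y := funext fun y => (hA y).fderiv
    have hcn : 0 ≤ u'' ‖x‖ - φ ‖x‖ := by
      rcases eq_or_lt_of_le (norm_nonneg x) with h | h
      · rw [← h, hφ0]; simp
      · rw [hφ1 _ h]; linarith [hineq _ h]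
    have hP := aux_Pplus hk hkN (φ ‖x‖) (u'' ‖x‖ - φ ‖x‖) hcn (fun i => ‖x‖⁻¹ * x i) ?_
      (hessianMatrix (fun y => u ‖y‖) x) ?_
    · rw [hP]
      have := hode ‖x‖ (norm_nonneg x)
      linarith
    · by_cases hx : x = 0
      · left
        simp [hx, hφ0]
      · right
        have hr : ‖x‖ ≠ 0 := norm_ne_zero_iff.mpr hx
        have h2 := EuclideanSpace.real_norm_sq_eq x
        calc ∑ i, ‖x‖⁻¹ * x i * (‖x‖⁻¹ * x i) = (‖x‖⁻¹) ^ 2 * ∑ i, x i ^ 2 := by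
              rw [Finset.mul_sum]
              exact Finset.sum_congr rfl fun i _ => by ring
          _ = 1 := by rw [← h2]; field_simp
    · intro i j
      rw [hessianMatrix, iteratedFDeriv_two_apply, hfd, (hB x).fderiv]
      simp [EuclideanSpace.inner_single_right]
      simp only [eq_comm]
end

section
/- Let N and k be positive integers with 2 < k < N, and let k/(k−2) < p < (k+2)/(k−2). Then there is no radial positive classical solution of P⁺_k(D²u) + u^p = 0 in ℝ^N; that is, there is no function g : [0,∞) → (0,∞) such that u(x) = g(|x|) is C² on ℝ^N and satisfies P⁺_k(D²u(x)) + u(x)^p = 0 for every x ∈ ℝ^N. -/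
open scoped BigOperators

section helpers

open Filter Topology

lemma Pplus_diag {n k : ℕ} (hk : 1 ≤ k) (hkn : k < n) (i0 : Fin n) (a b : ℝ) :
    Pplus k (Matrix.diagonal (fun i => if i = i0 then a else b)) = max a b + ((k : ℝ) - 1) * b := by
  set d : Fin n → ℝ := fun i => if i = i0 then a else b with hd
  have hH : (Matrix.diagonal d).IsHermitian := Matrix.isHermitian_diagonal d
  have hm : Multiset.map hH.eigenvalues Finset.univ.val = Multiset.map d Finset.univ.val := by
    have e1 := hH.roots_charpoly_eq_eigenvalues
    rw [Matrix.charpoly_diagonal] at e1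
    have e2 : (∏ i, (Polynomial.X - Polynomial.C (d i))).roots = Multiset.map d Finset.univ.val := by
      have e3 := Multiset.map_map (fun x => Polynomial.X - Polynomial.C x) d Finset.univ.val
      rw [Finset.prod_eq_multiset_prod]
      simp only [Function.comp_def] at e3
      rw [← e3, Polynomial.roots_multiset_prod_X_sub_C]
    rw [e2] at e1
    simpa using e1.symm
  obtain ⟨σ, hσ⟩ : ∃ σ : Equiv.Perm (Fin n), hH.eigenvalues ∘ σ = d := by
    have hcard : ∀ c, Nonempty ({i // d i = c} ≃ {i // hH.eigenvalues i = c}) := by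
      intro c
      refine Fintype.card_eq.1 ?_
      have e1 := congrArg (Multiset.count c) hm
      rw [Multiset.count_map, Multiset.count_map] at e1
      rw [Fintype.card_subtype, Fintype.card_subtype, Finset.card_def, Finset.card_def,
        Finset.filter_val, Finset.filter_val]
      simp only [eq_comm (a := c)] at e1
      exact e1.symm
    exact ⟨Equiv.ofFiberEquiv (fun c => (hcard c).some),
      funext fun i => Equiv.ofFiberEquiv_map _ i⟩
  set f := sortedEig (Matrix.diagonal d) with hf
  have hfe : f = hH.eigenvalues ∘ Tuple.sort hH.eigenvalues := by
    rw [hf, sortedEig, dif_pos hH]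
  have hmono : Monotone f := by rw [hfe]; exact Tuple.monotone_sort _
  obtain ⟨j0, hj⟩ : ∃ j0, ∀ j, f j = if j = j0 then a else b := by
    refine ⟨(Tuple.sort hH.eigenvalues).symm (σ i0), fun j => ?_⟩
    have : f j = d (σ.symm (Tuple.sort hH.eigenvalues j)) := by
      rw [hfe, ← congrFun hσ]; simp
    rw [this]
    simp only [d, Equiv.symm_apply_eq, Equiv.eq_symm_apply]
  have hsum : Pplus k (Matrix.diagonal d) = (k : ℝ) * b + if n - k ≤ (j0 : ℕ) then a - b else 0 := by
    have e1 : ∀ i : Fin n, (if n - k ≤ (i : ℕ) then f i else 0) =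
        (if n - k ≤ (i : ℕ) then b else 0) +
          (if i = j0 then (if n - k ≤ (j0 : ℕ) then a - b else 0) else 0) := by
      intro i
      rw [hj i]
      split_ifs <;> simp_all
    rw [Pplus, ← hf, Finset.sum_congr rfl (fun i _ => e1 i), Finset.sum_add_distrib,
      Finset.sum_ite_eq' Finset.univ j0, if_pos (Finset.mem_univ _)]
    congr 1
    rw [Fin.sum_univ_eq_sum_range (fun i => if n - k ≤ i then b else 0) n]
    have : n = (n - k) + k := by omega
    rw [this, Finset.sum_range_add, ← this]
    rw [Finset.sum_eq_zero, zero_add, Finset.sum_congr rfl (g := fun _ => b)]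
    · simp
    · intro i _; rw [if_pos (by omega)]
    · intro i hi; rw [Finset.mem_range] at hi; rw [if_neg (by omega)]
  rw [hsum]
  rcases lt_trichotomy a b with hab | hab | hab
  · have : (j0 : ℕ) = 0 := by
      by_contra hne
      have h3 := hmono (show (⟨0, by omega⟩ : Fin n) ≤ j0 from Fin.mk_le_of_le_val (by omega))
      rw [hj, hj, if_pos rfl, if_neg (by intro h; apply hne; rw [← h])] at h3
      linarith
    rw [max_eq_right hab.le, if_neg (by omega)]; ring
  · subst hab; simp; ring
  · have : (j0 : ℕ) = n - 1 := by
      by_contra hne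
      have h3 := hmono (show j0 ≤ (⟨n - 1, by omega⟩ : Fin n) from
        Fin.le_def.2 (by have := j0.2; simp only; omega))
      rw [hj, hj, if_pos rfl, if_neg (by intro h; apply hne; rw [← h])] at h3
      linarith
    rw [max_eq_left hab.le, if_pos (by omega)]; ring

lemma ode_false (k : ℕ) (hk : 2 < k) (p : ℝ)
    (hp1 : (k : ℝ) / ((k : ℝ) - 2) < p) (hp2 : p < ((k : ℝ) + 2) / ((k : ℝ) - 2))
    (h h1 h2 : ℝ → ℝ) (d1 : ∀ t, HasDerivAt h (h1 t) t) (d2 : ∀ t, HasDerivAt h1 (h2 t) t)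
    (hc : Continuous h2) (pos : ∀ t, 0 < h t)
    (eq : ∀ r, 0 < r → max (h2 r) (h1 r / r) + ((k : ℝ) - 1) * (h1 r / r) + h r ^ p = 0) :
    False := by
  have hkr : (2 : ℝ) < k := by exact_mod_cast hk
  have hk2 : (0 : ℝ) < k - 2 := by linarith
  have hp : 1 < p := by
    refine lt_trans ?_ hp1
    rw [lt_div_iff₀ hk2]; linarith
  have hp2' : p * (k - 2) < k + 2 := by rwa [lt_div_iff₀ hk2] at hp2
  have hpp : ∀ r, 0 < h r ^ p := fun r => Real.rpow_pos_of_pos (pos r) p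
  have hle : ∀ r, 0 < r → h1 r / r ≤ - h r ^ p / k := by
    intro r hr
    have := eq r hr
    have h3 := le_max_right (h2 r) (h1 r / r)
    rw [le_div_iff₀ (by linarith)]
    linarith
  have hneg : ∀ r, 0 < r → h1 r < 0 := by
    intro r hr
    have h3 := hle r hr
    have h4 : - h r ^ p / k < 0 := div_neg_of_neg_of_pos (by linarith [hpp r]) (by linarith)
    have h5 : h1 r / r < 0 := by linarith
    by_contra hcon
    push Not at hcon
    have := div_nonneg hcon hr.le
    linarith
  have c0 : Continuous h := continuous_iff_continuousAt.2 fun t => (d1 t).continuousAt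
  have c1 : Continuous h1 := continuous_iff_continuousAt.2 fun t => (d2 t).continuousAt
  have hge : ∀ r, 0 < r → h1 r / r ≤ h2 r := by
    intro r hr
    by_contra hcon
    push Not at hcon
    have hev : ∀ᶠ s in 𝓝 r, h2 s < h1 s / s :=
      (hc.continuousAt).eventually_lt (c1.continuousAt.div continuousAt_id hr.ne') hcon
    have hev2 : ∀ᶠ s in 𝓝 r, h1 s = - (s * h s ^ p) / k := by
      filter_upwards [hev, lt_mem_nhds hr] with s hs hs0
      have h3 := eq s hs0
      rw [max_eq_right hs.le] at h3
      field_simp at h3 ⊢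
      linarith
    have hd : HasDerivAt (fun s => - (s * h s ^ p) / k)
        (-(1 * h r ^ p + r * (h1 r * p * h r ^ (p - 1))) / k) r :=
      (((hasDerivAt_id r).mul ((d1 r).rpow_const (Or.inl (pos r).ne'))).neg).div_const _
    have hu := (d2 r).unique (hd.congr_of_eventuallyEq hev2)
    have h5 := hev2.self_of_nhds
    have h6 : h1 r / r = - h r ^ p / k := by
      rw [h5]; field_simp
    rw [h6, hu] at hcon
    have h7 : r * (h1 r * p * h r ^ (p - 1)) < 0 := by
      have := Real.rpow_pos_of_pos (pos r) (p - 1)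
      have h8 := hneg r hr
      have : 0 < r * (-h1 r * p * h r ^ (p - 1)) := by
        have : 0 < - h1 r := by linarith
        positivity
      linarith
    have h8 : -h r ^ p / k < -(1 * h r ^ p + r * (h1 r * p * h r ^ (p - 1))) / k := by
      apply div_lt_div_of_pos_right _ (by linarith)
      linarith
    linarith
  have heq : ∀ r, 0 < r → r * h2 r + ((k : ℝ) - 1) * h1 r + r * h r ^ p = 0 := by
    intro r hr
    have h3 := eq r hr
    rw [max_eq_left (hge r hr)] at h3
    field_simp at h3
    linarith
  -- phi
  have hphid : ∀ r, HasDerivAt (fun r => r * h1 r + ((k : ℝ) - 2) * h r)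
      (1 * h1 r + r * h2 r + (k - 2) * h1 r) r := fun r =>
    ((hasDerivAt_id r).mul (d2 r)).add ((d1 r).const_mul _)
  have hphi_anti : AntitoneOn (fun r => r * h1 r + ((k : ℝ) - 2) * h r) (Set.Ici 0) := by
    apply antitoneOn_of_deriv_nonpos (convex_Ici 0)
    · exact (continuous_iff_continuousAt.2 fun t => (hphid t).continuousAt).continuousOn
    · exact fun r _ => (hphid r).differentiableAt.differentiableWithinAt
    · intro r hr
      rw [interior_Ici] at hr
      rw [(hphid r).deriv]
      have h3 := heq r hr
      have : 0 < r * h r ^ p := mul_pos hr (hpp r)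
      linarith
  have hphi : ∀ r, 0 < r → 0 ≤ r * h1 r + ((k : ℝ) - 2) * h r := by
    intro r hr
    by_contra hcon
    push Not at hcon
    set c := -(r * h1 r + ((k : ℝ) - 2) * h r) with hcdef
    have hcp : 0 < c := by linarith
    have hb : ∀ s, r ≤ s → s * h1 s ≤ -c := by
      intro s hs
      have h3 := hphi_anti (Set.mem_Ici.2 hr.le) (Set.mem_Ici.2 (hr.le.trans hs)) hs
      simp only at h3
      have : 0 < ((k : ℝ) - 2) * h s := mul_pos hk2 (pos s)
      linarith
    have hLd : ∀ s, 0 < s → HasDerivAt (fun s => h s + c * Real.log s) (h1 s + c * s⁻¹) s :=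
      fun s hs => (d1 s).add ((Real.hasDerivAt_log hs.ne').const_mul c)
    have hL : AntitoneOn (fun s => h s + c * Real.log s) (Set.Ici r) := by
      apply antitoneOn_of_deriv_nonpos (convex_Ici r)
      · exact fun s hs => (hLd s (lt_of_lt_of_le hr hs)).continuousAt.continuousWithinAt
      · intro s hs
        rw [interior_Ici] at hs
        exact (hLd s (hr.trans hs)).differentiableAt.differentiableWithinAt
      · intro s hs
        rw [interior_Ici] at hs
        have hs0 : 0 < s := hr.trans hs
        rw [(hLd s hs0).deriv]
        have h3 := hb s (le_of_lt hs)
        have : h1 s + c * s⁻¹ = (s * h1 s + c) / s := by field_simp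
        rw [this]
        exact div_nonpos_of_nonpos_of_nonneg (by linarith) hs0.le
    have ht : Tendsto (fun s => c * Real.log s) atTop atTop :=
      Real.tendsto_log_atTop.const_mul_atTop hcp
    obtain ⟨s, hs1, hs2⟩ := ((ht.eventually_gt_atTop (h r + c * Real.log r)).and
      (eventually_ge_atTop r)).exists
    have h3 := hL (Set.mem_Ici.2 le_rfl) (Set.mem_Ici.2 hs2) hs2
    simp only at h3
    linarith [pos s]
  -- decay
  have hQd : ∀ r, HasDerivAt (fun r => h r ^ (1 - p) - (p - 1) / (2 * k) * r ^ 2)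
      (h1 r * (1 - p) * h r ^ (1 - p - 1) - (p - 1) / (2 * k) * (2 * r)) r := by
    intro r
    refine ((d1 r).rpow_const (Or.inl (pos r).ne')).sub ?_
    have := (hasDerivAt_pow 2 r).const_mul ((p - 1) / (2 * k))
    simpa using this
  have hQ : MonotoneOn (fun r => h r ^ (1 - p) - (p - 1) / (2 * k) * r ^ 2) (Set.Ici 0) := by
    apply monotoneOn_of_deriv_nonneg (convex_Ici 0)
    · exact fun r _ => (hQd r).continuousAt.continuousWithinAt
    · exact fun r _ => (hQd r).differentiableAt.differentiableWithinAt
    · intro r hr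
      rw [interior_Ici] at hr
      have hr : 0 < r := hr
      rw [(hQd r).deriv]
      have h3 := hle r hr
      have h4 : h1 r ≤ - (r * h r ^ p) / k := by
        rw [div_le_iff₀ hr] at h3
        calc _ ≤ _ := h3
          _ = _ := by ring
      have h5 : 1 - p - 1 = -p := by ring
      rw [h5]
      have h6 : h r ^ p * h r ^ (-p) = 1 := by
        rw [← Real.rpow_add (pos r)]; simp
      have h7 : 0 < h r ^ (-p) := Real.rpow_pos_of_pos (pos r) _
      have h8 : h1 r * h r ^ (-p) ≤ - r / k := by
        calc _ ≤ (- (r * h r ^ p) / k) * h r ^ (-p) := by gcongr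
          _ = - r / k * (h r ^ p * h r ^ (-p)) := by ring
          _ = _ := by rw [h6, mul_one]
      have h9 : (p - 1) / (2 * k) * (2 * r) = (p - 1) * (r / k) := by field_simp
      rw [h9]
      have : h1 r * (1 - p) * h r ^ (-p) = (p - 1) * (-(h1 r * h r ^ (-p))) := by ring
      rw [this]
      have : (p - 1) * (r / k) ≤ (p - 1) * (-(h1 r * h r ^ (-p))) := by
        apply mul_le_mul_of_nonneg_left _ (by linarith)
        rw [neg_div] at h8
        linarith
      linarith
  set a := (p - 1) / (2 * k) with ha
  have hap : 0 < a := div_pos (by linarith) (by linarith)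
  have hdec : ∀ r, 0 < r → a * r ^ 2 ≤ h r ^ (1 - p) := by
    intro r hr
    have h3 := hQ (Set.mem_Ici.2 le_rfl) (Set.mem_Ici.2 hr.le) hr.le
    simp only at h3
    have := Real.rpow_pos_of_pos (pos 0) (1 - p)
    nlinarith
  -- Pohozaev
  set H : ℝ → ℝ := fun r => r ^ k * (h1 r ^ 2 / 2 + h r ^ (p + 1) / (p + 1))
    + (k - 2) / 2 * (r ^ (k - 1) * (h r * h1 r)) with hH
  have hHc : Continuous H := by
    have : Continuous fun r => h r ^ (p + 1) := c0.rpow_const fun r => Or.inl (pos r).ne'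
    fun_prop
  have hHd : ∀ r, 0 < r → HasDerivAt H
      ((k / (p + 1) - (k - 2) / 2) * (r ^ (k - 1) * h r ^ (p + 1))) r := by
    intro r hr
    have e1 : HasDerivAt (fun r => h1 r ^ 2 / 2 + h r ^ (p + 1) / (p + 1))
        (2 * h1 r * h2 r / 2 + h1 r * (p + 1) * h r ^ (p + 1 - 1) / (p + 1)) r := by
      refine HasDerivAt.add (HasDerivAt.div_const ?_ 2)
        (((d1 r).rpow_const (Or.inl (pos r).ne')).div_const _)
      exact ((d2 r).pow 2).congr_deriv (by simp)
    have e2 := ((hasDerivAt_pow k r).mul e1).add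
      (((hasDerivAt_pow (k - 1) r).mul ((d1 r).mul (d2 r))).const_mul (((k : ℝ) - 2) / 2))
    refine e2.congr_deriv ?_
    obtain ⟨m, rfl⟩ : ∃ m, k = m + 2 := ⟨k - 2, by omega⟩
    have e3 := heq r hr
    have e4 : p + 1 - 1 = p := by ring
    have e5 : h r ^ (p + 1) = h r ^ p * h r := by
      rw [Real.rpow_add (pos r), Real.rpow_one]
    have e6 : m + 2 - 1 - 1 = m := by omega
    have e7 : m + 2 - 1 = m + 1 := by omega
    have e8 : p + 1 ≠ 0 := by linarith
    rw [e4, e5, e6, e7, Pi.mul_apply]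
    push_cast at e3 ⊢
    have hinv : (p + 1) * (p + 1)⁻¹ = 1 := mul_inv_cancel₀ e8
    linear_combination (r ^ (m + 1) * h1 r + m / 2 * r ^ m * h r) * e3
      + (r ^ (m + 2) * h1 r * h r ^ p) * hinv
  have hHm : StrictMonoOn H (Set.Ici 0) := by
    apply strictMonoOn_of_deriv_pos (convex_Ici 0) hHc.continuousOn
    intro r hr
    rw [interior_Ici] at hr
    have hr : 0 < r := hr
    rw [(hHd r hr).deriv]
    have := Real.rpow_pos_of_pos (pos r) (p + 1)
    have : 0 < (k : ℝ) / (p + 1) - (k - 2) / 2 := by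
      rw [sub_pos, div_lt_div_iff₀ (by norm_num) (by linarith)]
      linarith
    positivity
  have hH0 : H 0 = 0 := by
    simp only [hH]
    rw [zero_pow (by omega), zero_pow (by omega)]; ring
  have hH1 : 0 < H 1 := by
    rw [← hH0]; exact hHm (by simp) (by simp) one_pos
  have hub : ∀ r, 1 ≤ r → H 1 ≤ r ^ k * h r ^ (p + 1) := by
    intro r hr
    have hr0 : 0 < r := by linarith
    have e1 := hHm.monotoneOn (by simp : (1:ℝ) ∈ Set.Ici 0) (Set.mem_Ici.2 hr0.le) hr
    have e2 := hphi r hr0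
    have e3 := hneg r hr0
    have e4 : H r = r ^ k * h r ^ (p + 1) / (p + 1) +
        r ^ (k - 1) * (h1 r * (r * h1 r + (k - 2) * h r)) / 2 := by
      simp only [hH]
      obtain ⟨m, rfl⟩ : ∃ m, k = m + 1 := ⟨k - 1, by omega⟩
      simp only [Nat.add_sub_cancel]
      push_cast
      ring
    have e5 : r ^ (k - 1) * (h1 r * (r * h1 r + (k - 2) * h r)) / 2 ≤ 0 := by
      apply div_nonpos_of_nonpos_of_nonneg _ (by norm_num)
      exact mul_nonpos_of_nonneg_of_nonpos (by positivity)
        (mul_nonpos_of_nonpos_of_nonneg e3.le e2)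
    have e6 : r ^ k * h r ^ (p + 1) / (p + 1) ≤ r ^ k * h r ^ (p + 1) := by
      apply div_le_self _ (by linarith)
      have := Real.rpow_pos_of_pos (pos r) (p + 1)
      positivity
    linarith
  -- final bound
  set b := (p + 1) / (p - 1) with hb
  have hbp : 0 < b := div_pos (by linarith) (by linarith)
  have hfin : ∀ r : ℝ, 1 ≤ r → H 1 ≤ a ^ (-b) * r ^ ((k : ℝ) - 2 * b) := by
    intro r hr
    have hr0 : 0 < r := by linarith
    refine (hub r hr).trans ?_
    have e1 : h r ^ (p + 1) = (h r ^ (1 - p)) ^ (-b) := by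
      rw [← Real.rpow_mul (pos r).le]
      congr 1
      rw [hb]
      have : p - 1 ≠ 0 := by linarith
      field_simp
      ring
    have e2 : (h r ^ (1 - p)) ^ (-b) ≤ (a * r ^ 2) ^ (-b) :=
      Real.rpow_le_rpow_of_nonpos (by positivity) (hdec r hr0) (by linarith)
    rw [e1]
    calc _ ≤ r ^ k * (a * r ^ 2) ^ (-b) := by gcongr
      _ = _ := by
        rw [Real.mul_rpow hap.le (by positivity), ← Real.rpow_natCast, ← Real.rpow_natCast,
          ← Real.rpow_mul hr0.le, mul_left_comm, ← Real.rpow_add hr0]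
        congr 2
        push_cast; ring
  have hexp : (k : ℝ) - 2 * b < 0 := by
    have : (k : ℝ) / 2 < b := by
      rw [hb, div_lt_div_iff₀ (by norm_num) (by linarith)]
      linarith
    linarith
  have ht : Tendsto (fun r : ℝ => a ^ (-b) * r ^ ((k : ℝ) - 2 * b)) atTop (𝓝 (a ^ (-b) * 0)) := by
    apply Tendsto.const_mul
    have := tendsto_rpow_neg_atTop (y := -((k : ℝ) - 2 * b)) (by linarith)
    simpa using this
  rw [mul_zero] at ht
  obtain ⟨r, hr1, hr2⟩ := ((ht.eventually_lt_const hH1).and (eventually_ge_atTop 1)).exists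
  linarith [hfin r hr2]

lemma fderiv_radial {E : Type*} [NormedAddCommGroup E] [InnerProductSpace ℝ E]
    (h h1 : ℝ → ℝ) (d1 : ∀ t, HasDerivAt h (h1 t) t) (y : E) (hy : y ≠ 0) :
    HasFDerivAt (fun y : E => h ‖y‖) ((h1 ‖y‖ / ‖y‖) • innerSL ℝ y) y := by
  have hn : HasFDerivAt (fun y : E => ‖y‖) (‖y‖⁻¹ • innerSL ℝ y) y := by
    have hny : ‖y‖ ≠ 0 := norm_ne_zero_iff.2 hy
    have e1 := (hasStrictFDerivAt_norm_sq y).hasFDerivAt.sqrt (by positivity)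
    simp only [Real.sqrt_sq (norm_nonneg _)] at e1
    refine e1.congr_fderiv ?_
    ext v
    simp
    field_simp
  refine ((d1 ‖y‖).comp_hasFDerivAt y hn).congr_fderiv ?_
  rw [smul_smul]; rfl

lemma hess_radial_s10 {E : Type*} [NormedAddCommGroup E] [InnerProductSpace ℝ E]
    (h h1 h2 : ℝ → ℝ) (d1 : ∀ t, HasDerivAt h (h1 t) t) (d2 : ∀ t, HasDerivAt h1 (h2 t) t)
    (y : E) (hy : y ≠ 0) (v w : E) :
    iteratedFDeriv ℝ 2 (fun y : E => h ‖y‖) y ![v, w] =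
      (h2 ‖y‖ - h1 ‖y‖ / ‖y‖) * (inner ℝ y v / ‖y‖) * (inner ℝ y w / ‖y‖)
        + h1 ‖y‖ / ‖y‖ * inner ℝ v w := by
  have hny : ‖y‖ ≠ 0 := norm_ne_zero_iff.2 hy
  rw [iteratedFDeriv_two_apply]
  have hev : fderiv ℝ (fun y : E => h ‖y‖) =ᶠ[𝓝 y]
      fun z => (h1 ‖z‖ / ‖z‖) • innerSL ℝ z := by
    filter_upwards [isOpen_ne.mem_nhds hy] with z hz
    exact (fderiv_radial h h1 d1 z hz).fderiv
  rw [hev.fderiv_eq]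
  have e1 := fderiv_radial h1 h2 d2 y hy
  have e2 : HasFDerivAt (fun y : E => ‖y‖) ((1 / ‖y‖) • innerSL ℝ y) y :=
    fderiv_radial (fun t => t) (fun _ => 1) (fun t => hasDerivAt_id t) y hy
  have e3 : HasDerivAt (fun t => t⁻¹) (-(‖y‖ ^ 2)⁻¹) ‖y‖ := hasDerivAt_inv hny
  have e4 := e1.mul (e3.comp_hasFDerivAt y e2)
  have e5 := e4.smul (innerSL ℝ (E := E)).hasFDerivAt (x := y)
  have e6 : HasFDerivAt (fun z : E => (h1 ‖z‖ / ‖z‖) • innerSL ℝ z) _ y := e5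
  rw [e6.fderiv]
  simp [div_eq_mul_inv]
  rw [innerSL_apply_apply, innerSL_apply_apply]
  field_simp
  ring

end helpers

theorem statement10 (N k : ℕ) (hk2 : 2 < k) (hkN : k < N) (p : ℝ)
    (hp1 : (k : ℝ) / ((k : ℝ) - 2) < p) (hp2 : p < ((k : ℝ) + 2) / ((k : ℝ) - 2)) :
    ¬ ∃ g : ℝ → ℝ, (∀ r : ℝ, 0 ≤ r → 0 < g r) ∧
      ContDiff ℝ 2 (fun x : EuclideanSpace ℝ (Fin N) => g ‖x‖) ∧
      ∀ x : EuclideanSpace ℝ (Fin N),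
        Pplus k (hessianMatrix (fun y => g ‖y‖) x) + g ‖x‖ ^ p = 0 := by
  rintro ⟨g, gpos, gC, geq⟩
  set e : EuclideanSpace ℝ (Fin N) := EuclideanSpace.single (⟨0, by omega⟩ : Fin N) (1 : ℝ) with he
  have hen : ‖e‖ = 1 := by simp [he]
  have hne : ∀ t : ℝ, ‖t • e‖ = |t| := fun t => by rw [norm_smul, hen]; simp
  set h : ℝ → ℝ := fun t => g ‖t • e‖ with hh
  have hC : ContDiff ℝ 2 h := gC.comp (contDiff_id.smul contDiff_const)
  have hC1 : ContDiff ℝ 1 (deriv h) := by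
    have : ContDiff ℝ (1 + 1) h := by norm_num; exact hC
    exact (contDiff_succ_iff_deriv.1 this).2.2
  have d1 : ∀ t, HasDerivAt h (deriv h t) t := fun t =>
    (hC.differentiable (by norm_num) t).hasDerivAt
  have d2 : ∀ t, HasDerivAt (deriv h) (deriv (deriv h) t) t := fun t =>
    (hC1.differentiable (by norm_num) t).hasDerivAt
  have hu : (fun y : EuclideanSpace ℝ (Fin N) => g ‖y‖) = fun y => h ‖y‖ := by
    funext y; simp only [hh]; rw [hne, abs_norm]
  refine ode_false k hk2 p hp1 hp2 h (deriv h) (deriv (deriv h)) d1 d2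
    (hC1.continuous_deriv le_rfl) (fun t => gpos _ (norm_nonneg _)) ?_
  intro r hr
  have h3 := geq (r • e)
  have hnr : ‖r • e‖ = r := by rw [hne, abs_of_pos hr]
  have hmat : hessianMatrix (fun y : EuclideanSpace ℝ (Fin N) => g ‖y‖) (r • e) =
      Matrix.diagonal (fun i => if i = (⟨0, by omega⟩ : Fin N) then deriv (deriv h) r
        else deriv h r / r) := by
    ext i j
    rw [hu, hessianMatrix, hess_radial_s10 h (deriv h) (deriv (deriv h)) d1 d2 (r • e)
      (by rw [← norm_ne_zero_iff, hnr]; exact hr.ne'), hnr, Matrix.diagonal_apply]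
    have e1 : ∀ i : Fin N, inner ℝ (r • e) (EuclideanSpace.single i (1 : ℝ)) / r =
        if i = (⟨0, by omega⟩ : Fin N) then 1 else 0 := by
      intro i
      rw [inner_smul_left, he, EuclideanSpace.inner_single_left]
      by_cases hi : i = (⟨0, by omega⟩ : Fin N)
      · simp [hi, hr.ne']
      · simp [hi, eq_comm]
    rw [e1, e1, EuclideanSpace.inner_single_left]
    simp only [PiLp.single_apply]
    by_cases hij : i = j
    · subst hij
      by_cases hi : i = (⟨0, by omega⟩ : Fin N)
      · simp [hi]
      · simp [hi]
    · by_cases hi : i = (⟨0, by omega⟩ : Fin N)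
      · have : j ≠ (⟨0, by omega⟩ : Fin N) := fun hj => hij (hi.trans hj.symm)
        simp [hij, this]
      · simp [hij, hi]
  rw [hmat, Pplus_diag (by omega) hkN] at h3
  exact h3
end

section
/- Let N and k be positive integers with k < N, and let p > 0. Then there exists a bounded, continuous, nonnegative function u on the closure of ℝ^N_+ which is a viscosity solution of P⁻_k(D²u) + u^p = 0 in ℝ^N_+, satisfies u(x′, 0) = 0 for all x′ ∈ ℝ^{N−1}, and satisfies the uniform limsup condition: there exist c > 0 and a sequence t_n → +∞ such that u(x′, t_n) ≥ c for every x′ ∈ ℝ^{N−1} and every n. -/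
open scoped BigOperators

open Filter Topology

namespace St11

/-- The (everywhere positive) density used to define the inverse of the phase. -/
noncomputable def dens (b x : ℝ) : ℝ := if Real.sin x = 0 then 1 else |Real.sin x| ^ b

lemma dens_pos (b x : ℝ) : 0 < dens b x := by
  unfold dens
  split_ifs with h
  · exact one_pos
  · exact Real.rpow_pos_of_pos (abs_pos.mpr h) b

lemma dens_periodic (b : ℝ) : Function.Periodic (dens b) Real.pi := by
  intro x
  simp [dens, Real.sin_add_pi]

lemma dens_meas (b : ℝ) : Measurable (dens b) := by
  unfold dens
  refine Measurable.ite ?_ measurable_const ?_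
  · exact measurableSet_eq_fun Real.measurable_sin measurable_const
  · fun_prop

lemma dens_int_half (b : ℝ) (hb : -1 < b) :
    IntervalIntegrable (dens b) MeasureTheory.volume 0 (Real.pi / 2) := by
  have hdom : IntervalIntegrable (fun x : ℝ => 1 + (2 / Real.pi) ^ b * x ^ b)
      MeasureTheory.volume 0 (Real.pi / 2) :=
    (intervalIntegrable_const).add
      ((intervalIntegral.intervalIntegrable_rpow' hb).const_mul _)
  refine hdom.mono_fun (dens_meas b).aestronglyMeasurable ?_
  rw [Filter.EventuallyLE, MeasureTheory.ae_restrict_iff' measurableSet_uIoc]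
  refine Filter.Eventually.of_forall fun x hx => ?_
  have hpi := Real.pi_pos
  rw [Set.uIoc_of_le (by positivity)] at hx
  obtain ⟨h0, h1⟩ := hx
  have hs : 0 < Real.sin x := Real.sin_pos_of_pos_of_lt_pi h0 (by linarith)
  have hle : 2 / Real.pi * x ≤ Real.sin x := Real.mul_le_sin h0.le h1
  have hx0 : 0 < 2 / Real.pi * x := by positivity
  have hr : (0:ℝ) ≤ (2 / Real.pi) ^ b * x ^ b := by positivity
  rw [Real.norm_of_nonneg (dens_pos b x).le, Real.norm_of_nonneg (by linarith)]
  rw [← Real.mul_rpow (by positivity) h0.le]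
  have hq : 0 < (2 / Real.pi * x) ^ b := Real.rpow_pos_of_pos hx0 b
  simp only [dens, hs.ne', if_false, abs_of_pos hs]
  rcases le_total 0 b with hb0 | hb0
  · have := Real.rpow_le_one hs.le (Real.sin_le_one x) hb0
    linarith
  · have := Real.rpow_le_rpow_of_nonpos hx0 hle hb0
    linarith

lemma dens_int (b : ℝ) (hb : -1 < b) (x y : ℝ) :
    IntervalIntegrable (dens b) MeasureTheory.volume x y := by
  refine (dens_periodic b).intervalIntegrable₀ Real.pi_pos.ne' ?_ x y
  have h1 := dens_int_half b hb
  refine h1.trans ?_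
  have h2 := (h1.comp_sub_left Real.pi).symm
  have e : (fun x => dens b (Real.pi - x)) = dens b := by
    funext x; simp [dens, Real.sin_pi_sub]
  rw [e] at h2
  convert h2 using 1 <;> ring

/-- The inverse phase. -/
noncomputable def Fp (b x : ℝ) : ℝ := ∫ y in (0:ℝ)..x, dens b y

lemma Fp_strictMono (b : ℝ) (hb : -1 < b) : StrictMono (Fp b) := by
  intro x y hxy
  have h := intervalIntegral.intervalIntegral_pos_of_pos (dens_int b hb x y) (dens_pos b) hxy
  have := intervalIntegral.integral_add_adjacent_intervals (dens_int b hb 0 x) (dens_int b hb x y)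
  unfold Fp
  linarith

lemma Fp_pos (b : ℝ) (hb : -1 < b) : 0 < ∫ y in (0:ℝ)..Real.pi, dens b y :=
  intervalIntegral.intervalIntegral_pos_of_pos (dens_int b hb 0 Real.pi) (dens_pos b) Real.pi_pos

lemma Fp_top (b : ℝ) (hb : -1 < b) : Tendsto (Fp b) atTop atTop :=
  (dens_periodic b).tendsto_atTop_intervalIntegral_of_pos (Fp_pos b hb) Real.pi_pos

lemma Fp_bot (b : ℝ) (hb : -1 < b) : Tendsto (Fp b) atBot atBot :=
  (dens_periodic b).tendsto_atBot_intervalIntegral_of_pos (Fp_pos b hb) Real.pi_pos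

lemma Fp_cont (b : ℝ) (hb : -1 < b) : Continuous (Fp b) :=
  intervalIntegral.continuous_primitive (dens_int b hb) 0

lemma Fp_deriv (b : ℝ) (hb : -1 < b) (x : ℝ) (hx : Real.sin x ≠ 0) :
    HasDerivAt (Fp b) (|Real.sin x| ^ b) x := by
  have hc : ContinuousAt (dens b) x := by
    have h1 : ContinuousAt (fun x => |Real.sin x| ^ b) x :=
      ContinuousAt.rpow_const (by fun_prop) (Or.inl (abs_ne_zero.mpr hx))
    refine h1.congr ?_
    have : ∀ᶠ y in 𝓝 x, Real.sin y ≠ 0 := Real.continuous_sin.continuousAt.eventually_ne hx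
    filter_upwards [this] with y hy
    simp [dens, hy]
  have h := intervalIntegral.integral_hasDerivAt_right (dens_int b hb 0 x)
    ((dens_meas b).stronglyMeasurable.stronglyMeasurableAtFilter) hc
  have e : dens b x = |Real.sin x| ^ b := by simp [dens, hx]
  rw [e] at h
  exact h

/-- Existence of the phase. -/
lemma exists_phase (b : ℝ) (hb : -1 < b) : ∃ θ : ℝ → ℝ, Continuous θ ∧ Function.Injective θ ∧
    (∀ x, θ (Fp b x) = x) ∧ (∀ t, Real.sin (θ t) ≠ 0 →
      HasDerivAt θ (|Real.sin (θ t)| ^ b)⁻¹ t) := by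
  have hsurj : Function.Surjective (Fp b) :=
    (Fp_cont b hb).surjective (Fp_top b hb) (Fp_bot b hb)
  let e : ℝ ≃o ℝ := StrictMono.orderIsoOfSurjective _ (Fp_strictMono b hb) hsurj
  have he : ∀ x, e x = Fp b x := fun x => rfl
  refine ⟨e.symm, e.symm.continuous, e.symm.injective, fun x => ?_, fun t ht => ?_⟩
  · rw [← he]; simp
  · refine HasDerivAt.of_local_left_inverse (e.symm.continuous.continuousAt)
      (Fp_deriv b hb _ ht) ?_ ?_
    · exact (Real.rpow_pos_of_pos (abs_pos.mpr ht) b).ne'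
    · exact Filter.Eventually.of_forall fun y => by rw [← he]; simp

lemma sign_eventually (x : ℝ) (hx : x ≠ 0) : ∀ᶠ y in 𝓝 x, Real.sign y = Real.sign x := by
  rcases lt_or_gt_of_ne hx with h | h
  · filter_upwards [Iio_mem_nhds h] with y hy
    rw [Real.sign_of_neg h, Real.sign_of_neg hy]
  · filter_upwards [Ioi_mem_nhds h] with y hy
    rw [Real.sign_of_pos h, Real.sign_of_pos hy]

lemma abs_eq_sign (x : ℝ) : |x| = Real.sign x * x := by
  rcases lt_trichotomy x 0 with h | h | h
  · rw [Real.sign_of_neg h, abs_of_neg h]; ring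
  · simp [h]
  · rw [Real.sign_of_pos h, abs_of_pos h]; ring

/-- The one-dimensional profile. -/
lemma exists_profile (p : ℝ) (hp : 0 < p) : ∃ U V : ℝ → ℝ, ∃ a : ℝ, 0 < a ∧ Continuous U ∧
    (∀ t, 0 ≤ U t) ∧ (∀ t, U t ≤ 1) ∧ U 0 = 0 ∧
    (∀ t, U t ≠ 0 → (∀ᶠ s in 𝓝 t, HasDerivAt U (V s) s) ∧ HasDerivAt V (-(U t) ^ p) t) ∧
    (∀ t, U t = 0 → ∀ᶠ s in 𝓝[>] t, a * (s - t) ≤ U s) ∧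
    (∃ t : ℕ → ℝ, Tendsto t atTop atTop ∧ ∀ n, U (t n) = 1) := by
  obtain ⟨q, hq⟩ : ∃ q : ℝ, q = 2 / (p + 1) := ⟨_, rfl⟩
  have hq0 : 0 < q := by rw [hq]; positivity
  have hqp : q * p = 2 - q := by rw [hq]; field_simp; ring
  obtain ⟨a, ha0, haq⟩ : ∃ a : ℝ, 0 < a ∧ a * a = q :=
    ⟨Real.sqrt q, Real.sqrt_pos.mpr hq0, Real.mul_self_sqrt hq0.le⟩
  have hb : -1 < q - 1 := by linarith
  obtain ⟨θ, hθc, hθi, hθF, hθd⟩ := exists_phase (q - 1) hb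
  -- rescaled phase
  let ψ : ℝ → ℝ := fun t => θ (a⁻¹ * t)
  have hψc : Continuous ψ := by fun_prop
  have hψi : Function.Injective ψ := by
    intro x y hxy
    have := hθi hxy
    exact mul_left_cancel₀ (inv_pos.mpr ha0).ne' this
  have hψd : ∀ t, Real.sin (ψ t) ≠ 0 →
      HasDerivAt ψ ((|Real.sin (ψ t)| ^ (q - 1))⁻¹ * a⁻¹) t := by
    intro t ht
    have h1 : HasDerivAt (fun t : ℝ => a⁻¹ * t) a⁻¹ t := by
      simpa using (hasDerivAt_id t).const_mul a⁻¹
    exact (hθd (a⁻¹ * t) ht).comp t h1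
  let U : ℝ → ℝ := fun t => |Real.sin (ψ t)| ^ q
  let V : ℝ → ℝ := fun t => a * (Real.sign (Real.sin (ψ t)) * Real.cos (ψ t))
  have hUc : Continuous U := by
    refine Continuous.rpow_const (by fun_prop) (fun _ => Or.inr hq0.le)
  have hUne : ∀ t, U t ≠ 0 ↔ Real.sin (ψ t) ≠ 0 := by
    intro t
    simp only [U]
    rw [ne_eq, Real.rpow_eq_zero (abs_nonneg _) hq0.ne', abs_eq_zero]
  have hsine : ∀ t, Real.sin (ψ t) ≠ 0 → ∀ᶠ s in 𝓝 t, Real.sin (ψ s) ≠ 0 := fun t ht =>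
    (Real.continuous_sin.comp hψc).continuousAt.eventually_ne ht
  have hsign : ∀ t, Real.sin (ψ t) ≠ 0 →
      ∀ᶠ s in 𝓝 t, Real.sign (Real.sin (ψ s)) = Real.sign (Real.sin (ψ t)) := fun t ht =>
    (Real.continuous_sin.comp hψc).continuousAt.eventually (sign_eventually _ ht)
  have hUd : ∀ t, Real.sin (ψ t) ≠ 0 → HasDerivAt U (V t) t := by
    intro t ht
    have habs : 0 < |Real.sin (ψ t)| := abs_pos.mpr ht
    have h1 : HasDerivAt (fun s => Real.sign (Real.sin (ψ t)) * Real.sin (ψ s))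
        (Real.sign (Real.sin (ψ t)) *
          (Real.cos (ψ t) * ((|Real.sin (ψ t)| ^ (q - 1))⁻¹ * a⁻¹))) t :=
      ((hψd t ht).sin).const_mul _
    have h2 : HasDerivAt (fun s => |Real.sin (ψ s)|)
        (Real.sign (Real.sin (ψ t)) *
          (Real.cos (ψ t) * ((|Real.sin (ψ t)| ^ (q - 1))⁻¹ * a⁻¹))) t := by
      refine h1.congr_of_eventuallyEq ?_
      filter_upwards [hsign t ht] with s hs
      rw [abs_eq_sign, hs]
    have h3 := h2.rpow_const (p := q) (Or.inl habs.ne')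
    convert h3 using 1
    simp only [V]
    have hr : |Real.sin (ψ t)| ^ (q - 1) ≠ 0 := (Real.rpow_pos_of_pos habs _).ne'
    field_simp
    rw [pow_two, haq]
    ring
  have hVd : ∀ t, Real.sin (ψ t) ≠ 0 → HasDerivAt V (-(U t) ^ p) t := by
    intro t ht
    have habs : 0 < |Real.sin (ψ t)| := abs_pos.mpr ht
    have h1 : HasDerivAt (fun s => a * (Real.sign (Real.sin (ψ t)) * Real.cos (ψ s)))
        (a * (Real.sign (Real.sin (ψ t)) *
          (-Real.sin (ψ t) * ((|Real.sin (ψ t)| ^ (q - 1))⁻¹ * a⁻¹)))) t :=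
      (((hψd t ht).cos).const_mul _).const_mul _
    have h2 : HasDerivAt V (a * (Real.sign (Real.sin (ψ t)) *
          (-Real.sin (ψ t) * ((|Real.sin (ψ t)| ^ (q - 1))⁻¹ * a⁻¹)))) t := by
      refine h1.congr_of_eventuallyEq ?_
      filter_upwards [hsign t ht] with s hs
      simp only [V]
      rw [hs]
    convert h2 using 1
    have e1 : U t ^ p = |Real.sin (ψ t)| * (|Real.sin (ψ t)| ^ (q - 1))⁻¹ := by
      simp only [U]
      rw [← Real.rpow_mul habs.le, hqp, ← Real.rpow_neg habs.le]
      nth_rewrite 2 [← Real.rpow_one |Real.sin (ψ t)|]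
      rw [← Real.rpow_add habs]
      congr 1; ring
    rw [e1]
    nth_rewrite 1 [abs_eq_sign]
    field_simp
  refine ⟨U, V, a / 2, by positivity, hUc, fun t => by positivity, fun t => ?_, ?_, ?_, ?_, ?_⟩
  · exact Real.rpow_le_one (abs_nonneg _) (Real.abs_sin_le_one _) hq0.le
  · have : θ 0 = 0 := by
      have := hθF 0
      simpa [Fp] using this
    simp [U, ψ, this, Real.zero_rpow hq0.ne']
  · intro t ht
    rw [hUne] at ht
    refine ⟨?_, hVd t ht⟩
    filter_upwards [hsine t ht] with s hs using hUd s hs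
  · intro t ht
    have ht' : Real.sin (ψ t) = 0 := by
      by_contra h
      exact (hUne t).mpr h ht
    have hcos : |Real.cos (ψ t)| = 1 := by
      have := Real.sin_sq_add_cos_sq (ψ t)
      rw [ht'] at this
      have h2 : Real.cos (ψ t) ^ 2 = 1 := by linarith
      rw [← sq_abs] at h2
      nlinarith [abs_nonneg (Real.cos (ψ t))]
    have hcne : Real.cos (ψ t) ≠ 0 := by
      intro h; rw [h] at hcos; simp at hcos
    have h1 : ∀ᶠ z in 𝓝[≠] (ψ t), Real.sin z ≠ 0 :=
      (Real.hasDerivAt_sin (ψ t)).eventually_ne hcne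
    have h2 : Tendsto ψ (𝓝[≠] t) (𝓝[≠] (ψ t)) :=
      hψc.continuousAt.continuousWithinAt.tendsto_nhdsWithin
        (fun x hx h => hx (hψi h))
    have h3 : ∀ᶠ s in 𝓝[>] t, Real.sin (ψ s) ≠ 0 :=
      (h2.eventually h1).filter_mono (nhdsWithin_mono _ (fun x (hx : t < x) => hx.ne'))
    have h4 : ∀ᶠ s in 𝓝[>] t, 1 / 2 < |Real.cos (ψ s)| := by
      have hc : ContinuousAt (fun s => |Real.cos (ψ s)|) t := by fun_prop
      have : ∀ᶠ s in 𝓝 t, 1 / 2 < |Real.cos (ψ s)| :=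
        hc.eventually (lt_mem_nhds (by simp only [hcos]; norm_num))
      exact this.filter_mono nhdsWithin_le_nhds
    obtain ⟨r, hr, hsub⟩ := (mem_nhdsGT_iff_exists_Ioo_subset).mp (h3.and h4)
    filter_upwards [Ioo_mem_nhdsGT hr] with s hs
    obtain ⟨ξ, hξ, hξ2⟩ := exists_hasDerivAt_eq_slope U V hs.1 hUc.continuousOn
      (fun x hx => hUd x (hsub ⟨hx.1, hx.2.trans hs.2⟩).1)
    obtain ⟨k1, k2⟩ := hsub ⟨hξ.1, hξ.2.trans hs.2⟩
    have hpos : 0 < s - t := sub_pos.mpr hs.1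
    have hVU : U s = V ξ * (s - t) := by
      rw [hξ2, ht]; field_simp; ring
    have hVn : 0 ≤ V ξ := by
      rw [hξ2, ht]
      have : 0 ≤ U s := by positivity
      rw [sub_zero]; positivity
    have hVabs : V ξ = a * |Real.cos (ψ ξ)| := by
      rw [← abs_of_nonneg hVn]
      simp only [V]
      rw [abs_mul, abs_mul, abs_of_pos ha0]
      have : |Real.sign (Real.sin (ψ ξ))| = 1 := by
        rcases lt_or_gt_of_ne k1 with h | h
        · rw [Real.sign_of_neg h]; simp
        · rw [Real.sign_of_pos h]; simp
      rw [this, one_mul]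
    rw [hVU]
    refine mul_le_mul_of_nonneg_right ?_ hpos.le
    rw [hVabs]
    nlinarith
  · refine ⟨fun n => a * Fp (q - 1) (Real.pi / 2 + n * Real.pi), ?_, fun n => ?_⟩
    · refine Tendsto.const_mul_atTop ha0 ((Fp_top _ hb).comp ?_)
      refine tendsto_atTop_add_const_left _ _ ?_
      exact tendsto_natCast_atTop_atTop.atTop_mul_const Real.pi_pos
    · simp only [U, ψ]
      rw [inv_mul_cancel_left₀ ha0.ne', hθF]
      have : |Real.sin (Real.pi / 2 + n * Real.pi)| = 1 := by
        rw [Real.sin_add_nat_mul_pi]; simp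
      rw [this, Real.one_rpow]

lemma second_deriv_min (g g' : ℝ → ℝ) (d : ℝ) (hmin : IsLocalMin g 0)
    (h1 : ∀ᶠ s in 𝓝 (0:ℝ), HasDerivAt g (g' s) s) (h2 : HasDerivAt g' d 0) : 0 ≤ d := by
  by_contra hd
  push Not at hd
  have hder : deriv g =ᶠ[𝓝 0] g' := by
    filter_upwards [h1] with s hs using hs.deriv
  have hdd : deriv (deriv g) 0 = d := by
    rw [hder.deriv_eq, h2.deriv]
  have hmax : IsLocalMax g 0 := by
    have := isLocalMin_of_deriv_deriv_pos (f := fun x => - g x) (x₀ := 0) ?_ ?_ ?_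
    · simpa using this.neg
    · have e : deriv (fun x => - g x) = fun x => - deriv g x := by
        funext x; exact deriv.fun_neg
      rw [e, deriv.fun_neg, hdd]; linarith
    · rw [deriv.fun_neg, hmin.deriv_eq_zero, neg_zero]
    · exact h1.self_of_nhds.continuousAt.neg
  have hconst : g =ᶠ[𝓝 0] fun _ => g 0 := by
    filter_upwards [hmin, hmax] with s hs1 hs2 using le_antisymm hs2 hs1
  have : deriv g =ᶠ[𝓝 0] deriv (fun _ => g 0) := hconst.deriv
  have h0 : deriv (deriv g) 0 = 0 := by
    rw [this.deriv_eq]; simp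
  linarith

variable {N : ℕ}

lemma line_hasDerivAt (φ : EuclideanSpace ℝ (Fin N) → ℝ) (hφ : ContDiff ℝ 2 φ)
    (x w : EuclideanSpace ℝ (Fin N)) (s : ℝ) :
    HasDerivAt (fun s : ℝ => φ (x + s • w)) (fderiv ℝ φ (x + s • w) w) s := by
  have h1 : HasDerivAt (fun s : ℝ => x + s • w) w s := by
    simpa using ((hasDerivAt_id s).smul_const w).const_add x
  exact ((hφ.differentiable (by norm_num)) _).hasFDerivAt.comp_hasDerivAt s h1

lemma line_hasDerivAt2 (φ : EuclideanSpace ℝ (Fin N) → ℝ) (hφ : ContDiff ℝ 2 φ)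
    (x w : EuclideanSpace ℝ (Fin N)) :
    HasDerivAt (fun s : ℝ => fderiv ℝ φ (x + s • w) w) (fderiv ℝ (fderiv ℝ φ) x w w) 0 := by
  have h1 : HasDerivAt (fun s : ℝ => x + s • w) w 0 := by
    simpa using ((hasDerivAt_id (0:ℝ)).smul_const w).const_add x
  have hd : Differentiable ℝ (fderiv ℝ φ) :=
    (hφ.fderiv_right (m := 1) (by norm_num)).differentiable (by norm_num)
  have h2 : HasFDerivAt (fderiv ℝ φ) (fderiv ℝ (fderiv ℝ φ) x) (x + (0:ℝ) • w) := by
    simpa using (hd x).hasFDerivAt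
  have h3 := h2.comp_hasDerivAt (0:ℝ) h1
  exact (h3.clm_apply (hasDerivAt_const (0:ℝ) w)).congr_deriv (by simp)

lemma line_tendsto (x w : EuclideanSpace ℝ (Fin N)) :
    Tendsto (fun s : ℝ => x + s • w) (𝓝 0) (𝓝 x) := by
  have : Continuous (fun s : ℝ => x + s • w) := by fun_prop
  simpa using this.tendsto 0

/-- touching from below along a line. -/
lemma touch_below (u φ : EuclideanSpace ℝ (Fin N) → ℝ) (hφ : ContDiff ℝ 2 φ)
    (x w : EuclideanSpace ℝ (Fin N)) (hmin : IsLocalMin (fun y => u y - φ y) x)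
    (h' : ℝ → ℝ) (d : ℝ)
    (h1 : ∀ᶠ s in 𝓝 (0:ℝ), HasDerivAt (fun s : ℝ => u (x + s • w)) (h' s) s)
    (h2 : HasDerivAt h' d 0) : fderiv ℝ (fderiv ℝ φ) x w w ≤ d := by
  have := second_deriv_min (fun s : ℝ => u (x + s • w) - φ (x + s • w))
    (fun s => h' s - fderiv ℝ φ (x + s • w) w) (d - fderiv ℝ (fderiv ℝ φ) x w w) ?_ ?_ ?_
  · linarith
  · have := (line_tendsto x w).eventually hmin
    filter_upwards [this] with s hs
    simpa using hs
  · filter_upwards [h1] with s hs using hs.sub (line_hasDerivAt φ hφ x w s)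
  · exact h2.sub (line_hasDerivAt2 φ hφ x w)

lemma touch_above (u φ : EuclideanSpace ℝ (Fin N) → ℝ) (hφ : ContDiff ℝ 2 φ)
    (x w : EuclideanSpace ℝ (Fin N)) (hmax : IsLocalMax (fun y => u y - φ y) x)
    (h' : ℝ → ℝ) (d : ℝ)
    (h1 : ∀ᶠ s in 𝓝 (0:ℝ), HasDerivAt (fun s : ℝ => u (x + s • w)) (h' s) s)
    (h2 : HasDerivAt h' d 0) : d ≤ fderiv ℝ (fderiv ℝ φ) x w w := by
  have := second_deriv_min (fun s : ℝ => φ (x + s • w) - u (x + s • w))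
    (fun s => fderiv ℝ φ (x + s • w) w - h' s) (fderiv ℝ (fderiv ℝ φ) x w w - d) ?_ ?_ ?_
  · linarith
  · have := (line_tendsto x w).eventually hmax
    filter_upwards [this] with s hs
    simp only [zero_smul, add_zero]
    linarith
  · filter_upwards [h1] with s hs using (line_hasDerivAt φ hφ x w s).sub hs
  · exact (line_hasDerivAt2 φ hφ x w).sub h2

lemma hess_apply (φ : EuclideanSpace ℝ (Fin N) → ℝ) (x : EuclideanSpace ℝ (Fin N)) (i j : Fin N) :
    hessianMatrix φ x i j = fderiv ℝ (fderiv ℝ φ) x (EuclideanSpace.single i 1)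
      (EuclideanSpace.single j 1) := by
  simp [hessianMatrix, iteratedFDeriv_two_apply]

lemma hess_symm (φ : EuclideanSpace ℝ (Fin N) → ℝ) (hφ : ContDiff ℝ 2 φ)
    (x : EuclideanSpace ℝ (Fin N)) : (hessianMatrix φ x).IsHermitian := by
  ext i j
  simp only [Matrix.conjTranspose_apply, star_trivial, hess_apply]
  exact (hφ.contDiffAt.isSymmSndFDerivAt (by simp)) _ _

lemma hess_quad (φ : EuclideanSpace ℝ (Fin N) → ℝ) (x w : EuclideanSpace ℝ (Fin N)) :
    w.ofLp ⬝ᵥ (hessianMatrix φ x).mulVec w.ofLp = fderiv ℝ (fderiv ℝ φ) x w w := by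
  have hw : w = ∑ i, w i • EuclideanSpace.single i (1:ℝ) := by
    ext j
    simp [Pi.single_apply]
  conv_rhs => rw [hw]
  simp only [map_sum, map_smul, _root_.sum_apply, _root_.smul_apply,
    dotProduct, Matrix.mulVec, hess_apply, smul_eq_mul, Finset.mul_sum]
  rw [Finset.sum_comm]
  refine Finset.sum_congr rfl fun i _ => Finset.sum_congr rfl fun j _ => by ring

lemma eig_quad (A : Matrix (Fin N) (Fin N) ℝ) (hA : A.IsHermitian) (i : Fin N) :
    (hA.eigenvectorBasis i).ofLp ⬝ᵥ A.mulVec (hA.eigenvectorBasis i).ofLp = hA.eigenvalues i := by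
  rw [hA.mulVec_eigenvectorBasis, dotProduct_smul]
  have h : ‖hA.eigenvectorBasis i‖ ^ 2 = 1 := by simp
  rw [EuclideanSpace.real_norm_sq_eq] at h
  simp only [dotProduct, smul_eq_mul]
  simp only [← pow_two]
  rw [h, mul_one]

lemma basis_col (b : OrthonormalBasis (Fin N) ℝ (EuclideanSpace ℝ (Fin N))) (l : Fin N) :
    ∑ i, (b i l) ^ 2 = 1 := by
  have := b.sum_sq_norm_inner_right (EuclideanSpace.single l (1:ℝ))
  simpa [EuclideanSpace.inner_single_right] using this

lemma basis_row (b : OrthonormalBasis (Fin N) ℝ (EuclideanSpace ℝ (Fin N))) (i : Fin N) :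
    ∑ l, (b i l) ^ 2 = 1 := by
  have h : ‖b i‖ ^ 2 = 1 := by simp
  rwa [EuclideanSpace.real_norm_sq_eq] at h

lemma Pminus_eq (k : ℕ) (A : Matrix (Fin N) (Fin N) ℝ) (hA : A.IsHermitian) :
    Pminus k A = ∑ i : Fin N, if (i : ℕ) < k then
      hA.eigenvalues (Tuple.sort hA.eigenvalues i) else 0 := by
  unfold Pminus sortedEig
  rw [dif_pos hA]
  rfl

lemma Pminus_lower (k : ℕ) (A : Matrix (Fin N) (Fin N) ℝ) (hA : A.IsHermitian) (c : ℝ)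
    (hc : 0 ≤ c) (l : Fin N)
    (h : ∀ w : EuclideanSpace ℝ (Fin N), -c * (w l) ^ 2 ≤ w.ofLp ⬝ᵥ A.mulVec w.ofLp) :
    -c ≤ Pminus k A := by
  rw [Pminus_eq k A hA]
  calc -c = ∑ i, -c * (hA.eigenvectorBasis i l) ^ 2 := by
        rw [← Finset.mul_sum, basis_col, mul_one]
    _ = ∑ i, -c * (hA.eigenvectorBasis (Tuple.sort hA.eigenvalues i) l) ^ 2 :=
        (Equiv.sum_comp (Tuple.sort hA.eigenvalues)
          (fun i => -c * (hA.eigenvectorBasis i l) ^ 2)).symm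
    _ ≤ _ := by
        refine Finset.sum_le_sum fun i _ => ?_
        split_ifs
        · rw [← eig_quad A hA]; exact h _
        · nlinarith [sq_nonneg (hA.eigenvectorBasis (Tuple.sort hA.eigenvalues i) l)]

lemma diag_eq (A : Matrix (Fin N) (Fin N) ℝ) (hA : A.IsHermitian) (j : Fin N) :
    A j j = ∑ i, hA.eigenvalues i * (hA.eigenvectorBasis i j) ^ 2 := by
  have h := hA.spectral_theorem
  have h2 := congrFun (congrFun h j) j
  rw [Unitary.conjStarAlgAut_apply, Matrix.mul_apply] at h2
  rw [h2]
  refine Finset.sum_congr rfl fun i _ => ?_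
  simp [Matrix.mul_diagonal, Matrix.star_apply]
  ring

lemma Pminus_upper (k : ℕ) (hk : 0 < k) (hkN : k ≤ N) (A : Matrix (Fin N) (Fin N) ℝ)
    (hA : A.IsHermitian) (S : Finset (Fin N)) (hS : S.card = k) :
    Pminus k A ≤ ∑ j ∈ S, A j j := by
  rw [Pminus_eq k A hA]
  set σ := Tuple.sort hA.eigenvalues with hσ
  have hmono : Monotone (hA.eigenvalues ∘ σ) := Tuple.monotone_sort _
  let q : Fin N → ℝ := fun i => ∑ j ∈ S, (hA.eigenvectorBasis (σ i) j) ^ 2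
  have hq0 : ∀ i, 0 ≤ q i := fun i => Finset.sum_nonneg fun j _ => sq_nonneg _
  have hq1 : ∀ i, q i ≤ 1 := fun i => by
    rw [← basis_row hA.eigenvectorBasis (σ i)]
    exact Finset.sum_le_sum_of_subset_of_nonneg (Finset.subset_univ _) fun _ _ _ => sq_nonneg _
  have hqs : ∑ i, q i = k := by
    simp only [q]
    rw [Finset.sum_comm]
    have : ∀ j ∈ S, ∑ i, (hA.eigenvectorBasis (σ i) j) ^ 2 = 1 := fun j _ => by
      rw [Equiv.sum_comp σ (fun i => (hA.eigenvectorBasis i j) ^ 2), basis_col]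
    rw [Finset.sum_congr rfl this]
    simp [hS]
  have hind : ∑ i : Fin N, (if (i : ℕ) < k then (1:ℝ) else 0) = k := by
    rw [Finset.sum_boole]
    congr 1
    rw [Fin.card_filter_val_lt]
    omega
  have htr : ∑ j ∈ S, A j j = ∑ i, hA.eigenvalues (σ i) * q i := by
    have : ∀ j ∈ S, A j j =
        ∑ i, hA.eigenvalues (σ i) * (hA.eigenvectorBasis (σ i) j) ^ 2 := fun j _ => by
      rw [diag_eq A hA j]
      exact (Equiv.sum_comp σ
        (fun i => hA.eigenvalues i * (hA.eigenvectorBasis i j) ^ 2)).symm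
    rw [Finset.sum_congr rfl this, Finset.sum_comm]
    simp only [q, Finset.mul_sum]
  rw [htr]
  let m : ℝ := hA.eigenvalues (σ ⟨k - 1, by omega⟩)
  have key : 0 ≤ ∑ i : Fin N, (hA.eigenvalues (σ i) - m) *
      (q i - if (i : ℕ) < k then (1:ℝ) else 0) := by
    refine Finset.sum_nonneg fun i _ => ?_
    split_ifs with hi
    · have h1 : hA.eigenvalues (σ i) ≤ m := hmono (by
        rw [Fin.le_def]; simp only; omega)
      nlinarith [hq1 i]
    · have h1 : m ≤ hA.eigenvalues (σ i) := hmono (by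
        rw [Fin.le_def]; simp only; omega)
      nlinarith [hq0 i]
  have expand : ∑ i : Fin N, (hA.eigenvalues (σ i) - m) *
      (q i - if (i : ℕ) < k then (1:ℝ) else 0) =
      ∑ i, hA.eigenvalues (σ i) * q i
        - (∑ i : Fin N, if (i : ℕ) < k then hA.eigenvalues (σ i) else 0)
        - m * (∑ i, q i - ∑ i : Fin N, (if (i : ℕ) < k then (1:ℝ) else 0)) := by
    rw [← Finset.sum_sub_distrib, ← Finset.sum_sub_distrib, Finset.mul_sum,
      ← Finset.sum_sub_distrib]
    refine Finset.sum_congr rfl fun i _ => ?_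
    split_ifs <;> ring
  rw [expand, hqs, hind] at key
  linarith

lemma coord_hasDerivAt (l : Fin N) (x w : EuclideanSpace ℝ (Fin N)) (s : ℝ) :
    HasDerivAt (fun s : ℝ => (x + s • w) l) (w l) s := by
  simpa using ((hasDerivAt_id s).mul_const (w l)).const_add (x l)

lemma coord_tendsto (l : Fin N) (x w : EuclideanSpace ℝ (Fin N)) :
    Tendsto (fun s : ℝ => (x + s • w) l) (𝓝 0) (𝓝 (x l)) := by
  simpa using (coord_hasDerivAt l x w 0).continuousAt.tendsto

lemma profile_line (U V : ℝ → ℝ) (d : ℝ) (l : Fin N) (x w : EuclideanSpace ℝ (Fin N))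
    (h : (∀ᶠ s in 𝓝 (x l), HasDerivAt U (V s) s) ∧ HasDerivAt V d (x l)) :
    (∀ᶠ s in 𝓝 (0:ℝ), HasDerivAt (fun s : ℝ => U ((x + s • w) l)) (V ((x + s • w) l) * w l) s) ∧
    HasDerivAt (fun s : ℝ => V ((x + s • w) l) * w l) (d * w l * w l) 0 := by
  constructor
  · filter_upwards [(coord_tendsto l x w).eventually h.1] with s hs
    exact hs.comp s (coord_hasDerivAt l x w s)
  · have h2 : HasDerivAt V d ((x + (0:ℝ) • w) l) := by simpa using h.2
    exact (h2.comp (0:ℝ) (coord_hasDerivAt l x w 0)).mul_const (w l)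

lemma sub_point (k : ℕ) (p : ℝ) (hp : 0 < p) (U V : ℝ → ℝ) (a : ℝ) (ha : 0 < a)
    (hU0 : ∀ t, 0 ≤ U t)
    (hUd : ∀ t, U t ≠ 0 → (∀ᶠ s in 𝓝 t, HasDerivAt U (V s) s) ∧ HasDerivAt V (-(U t) ^ p) t)
    (hUl : ∀ t, U t = 0 → ∀ᶠ s in 𝓝[>] t, a * (s - t) ≤ U s)
    (l : Fin N) (x : EuclideanSpace ℝ (Fin N)) (φ : EuclideanSpace ℝ (Fin N) → ℝ)
    (hφ : ContDiff ℝ 2 φ) (hmax : IsLocalMax (fun y => U (y l) - φ y) x) :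
    0 ≤ Pminus k (hessianMatrix φ x) + (U (x l)) ^ p := by
  by_cases hz : U (x l) = 0
  · exfalso
    set w : EuclideanSpace ℝ (Fin N) := EuclideanSpace.single l 1 with hw
    have hwl : w l = 1 := by simp [hw]
    have hev : ∀ᶠ s in 𝓝 (0:ℝ), U (x l + s) ≤ φ (x + s • w) - φ x := by
      filter_upwards [(line_tendsto x w).eventually hmax] with s hs
      have e : (x + s • w) l = x l + s := by simp [hwl]
      rw [e, hz] at hs
      linarith
    have hd := line_hasDerivAt φ hφ x w 0
    have hmin : IsLocalMin (fun s : ℝ => φ (x + s • w)) 0 := by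
      filter_upwards [hev] with s hs
      have := hU0 (x l + s)
      simp only [zero_smul, add_zero]
      linarith
    have hzero := hmin.hasDerivAt_eq_zero hd
    rw [hzero] at hd
    have hsl := hd.tendsto_slope_zero_right
    have h1 : ∀ᶠ s in 𝓝[>] (0:ℝ), s⁻¹ • (φ (x + (0 + s) • w) - φ (x + (0:ℝ) • w)) < a :=
      hsl.eventually (gt_mem_nhds ha)
    have h2 : ∀ᶠ s in 𝓝[>] (0:ℝ), a * (x l + s - x l) ≤ U (x l + s) := by
      have ht : Tendsto (fun s : ℝ => x l + s) (𝓝[>] 0) (𝓝[>] (x l)) := by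
        refine tendsto_nhdsWithin_iff.mpr ⟨?_, ?_⟩
        · have : Continuous (fun s : ℝ => x l + s) := by fun_prop
          have := this.tendsto 0
          rw [add_zero] at this
          exact this.mono_left nhdsWithin_le_nhds
        · filter_upwards [self_mem_nhdsWithin] with s hs
          simpa using hs
      exact ht.eventually (hUl _ hz)
    have h3 : ∀ᶠ s in 𝓝[>] (0:ℝ), 0 < s := self_mem_nhdsWithin
    obtain ⟨s, k1, k2, k3, k4⟩ :=
      (h1.and (h2.and (h3.and (hev.filter_mono nhdsWithin_le_nhds)))).exists
    simp only [zero_add, zero_smul, add_zero, smul_eq_mul] at k1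
    have k5 : φ (x + s • w) - φ x < a * s := by
      rw [inv_mul_lt_iff₀ k3] at k1; linarith
    have k6 : a * (x l + s - x l) = a * s := by ring
    linarith
  · have hnn : 0 ≤ (U (x l)) ^ p := Real.rpow_nonneg (hU0 _) p
    have := Pminus_lower k (hessianMatrix φ x) (hess_symm φ hφ x) ((U (x l)) ^ p) hnn l ?_
    · linarith
    · intro w
      rw [hess_quad]
      obtain ⟨g1, g2⟩ := profile_line U V _ l x w (hUd _ hz)
      have := touch_above (fun y => U (y l)) φ hφ x w hmax _ _ g1 g2
      linarith [this, pow_two (w l), mul_assoc (-(U (x l)) ^ p) (w l) (w l),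
        congrArg (fun r => -(U (x l)) ^ p * r) (pow_two (w l))]

lemma super_point (k : ℕ) (hk : 0 < k) (hkN : k < N) (p : ℝ) (hp : 0 < p) (U V : ℝ → ℝ)
    (hUd : ∀ t, U t ≠ 0 → (∀ᶠ s in 𝓝 t, HasDerivAt U (V s) s) ∧ HasDerivAt V (-(U t) ^ p) t)
    (l : Fin N) (x : EuclideanSpace ℝ (Fin N)) (φ : EuclideanSpace ℝ (Fin N) → ℝ)
    (hφ : ContDiff ℝ 2 φ) (hmin : IsLocalMin (fun y => U (y l) - φ y) x) :
    Pminus k (hessianMatrix φ x) + (U (x l)) ^ p ≤ 0 := by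
  have hoff : ∀ j, j ≠ l → hessianMatrix φ x j j ≤ 0 := by
    intro j hj
    rw [hess_apply]
    refine touch_below (fun y => U (y l)) φ hφ x _ hmin (fun _ => 0) 0 ?_ (hasDerivAt_const _ _)
    refine Eventually.of_forall fun s => ?_
    have : (fun s : ℝ => U ((x + s • EuclideanSpace.single j (1:ℝ)) l)) = fun _ => U (x l) := by
      funext s; simp [hj.symm]
    rw [this]
    exact hasDerivAt_const _ _
  have hcard : (Finset.univ.erase l : Finset (Fin N)).card = N - 1 := by simp
  by_cases hz : U (x l) = 0
  · obtain ⟨S, hS, hSc⟩ := Finset.exists_subset_card_eq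
      (s := (Finset.univ.erase l : Finset (Fin N))) (n := k) (by omega)
    have h1 := Pminus_upper k hk hkN.le _ (hess_symm φ hφ x) S hSc
    have h2 : ∑ j ∈ S, hessianMatrix φ x j j ≤ 0 :=
      Finset.sum_nonpos fun j hj => hoff j (Finset.ne_of_mem_erase (hS hj))
    rw [hz, Real.zero_rpow hp.ne']
    linarith
  · obtain ⟨S, hS, hSc⟩ := Finset.exists_subset_card_eq
      (s := (Finset.univ.erase l : Finset (Fin N))) (n := k - 1) (by omega)
    have hlS : l ∉ S := fun h => Finset.ne_of_mem_erase (hS h) rfl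
    have h1 := Pminus_upper k hk hkN.le _ (hess_symm φ hφ x) (insert l S)
      (by rw [Finset.card_insert_of_notMem hlS]; omega)
    rw [Finset.sum_insert hlS] at h1
    have h2 : ∑ j ∈ S, hessianMatrix φ x j j ≤ 0 :=
      Finset.sum_nonpos fun j hj => hoff j (Finset.ne_of_mem_erase (hS hj))
    have h3 : hessianMatrix φ x l l ≤ -(U (x l)) ^ p := by
      rw [hess_apply]
      obtain ⟨g1, g2⟩ := profile_line U V _ l x (EuclideanSpace.single l 1) (hUd _ hz)
      have := touch_below (fun y => U (y l)) φ hφ x _ hmin _ _ g1 g2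
      simpa using this
    linarith

end St11

theorem statement11 (N k : ℕ) (hk : 0 < k) (hkN : k < N) (p : ℝ) (hp : 0 < p) :
    ∃ u : EuclideanSpace ℝ (Fin N) → ℝ,
      let lastIdx : Fin N := ⟨N - 1, by omega⟩
      let Ω : Set (EuclideanSpace ℝ (Fin N)) := {x | 0 < x lastIdx}
      (∃ M : ℝ, ∀ x ∈ closure Ω, |u x| ≤ M) ∧
      ContinuousOn u (closure Ω) ∧
      (∀ x ∈ closure Ω, 0 ≤ u x) ∧
      IsViscositySubsolution (Pminus k) (fun t => t ^ p) Ω u ∧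
      IsViscositySupersolution (Pminus k) (fun t => t ^ p) Ω u ∧
      (∀ x : EuclideanSpace ℝ (Fin N), x lastIdx = 0 → u x = 0) ∧
      (∃ c : ℝ, 0 < c ∧ ∃ t : ℕ → ℝ, Filter.Tendsto t Filter.atTop Filter.atTop ∧
        ∀ n : ℕ, ∀ x : EuclideanSpace ℝ (Fin N), x lastIdx = t n → c ≤ u x) := by
  obtain ⟨U, V, a, ha, hUc, hU0, hU1, hUz, hUd, hUl, t, ht, htU⟩ := St11.exists_profile p hp
  refine ⟨fun x => U (x ⟨N - 1, by omega⟩), ?_⟩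
  intro l Ω
  have hΩ : IsOpen Ω := isOpen_lt continuous_const (by fun_prop)
  refine ⟨⟨1, fun x _ => ?_⟩, ?_, fun x _ => hU0 _, ?_, ?_, ?_, 1, one_pos, t, ht, ?_⟩
  · rw [abs_of_nonneg (hU0 _)]; exact hU1 _
  · exact Continuous.continuousOn (by fun_prop)
  · intro x hx φ hφ hmax
    have hmax' := hmax.isLocalMax (hΩ.mem_nhds hx)
    exact St11.sub_point k p hp U V a ha hU0 hUd hUl l x φ hφ hmax'
  · intro x hx φ hφ hmin
    have hmin' := hmin.isLocalMin (hΩ.mem_nhds hx)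
    exact St11.super_point k hk hkN p hp U V hUd l x φ hφ hmin'
  · intro x hx
    change U (x l) = 0
    rw [hx, hUz]
  · intro n x hx
    change 1 ≤ U (x l)
    rw [hx, htU]
end
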